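/- Let D > 1 be a squarefree integer and K = ℚ(√D). If there exists a classical universal quadratic O_K-lattice of rank 3 over K, then D ∈ {2, 3, 5}. -/

import Mathlib

open NumberField

/-- The Gram data of the orthogonal complement of a vector of norm one in a ternary classical
universal lattice over `ℚ(√D)`.  The value `S y z` is twice the bilinear form, with `(a, b)`
standing for `a + b√D`. -/
structure ComplementData (D : ℤ) where
  M : Type
  S : M → M → ℤ√D
  integral : ∀ y z, 4 ∣ (S y z).re ^ 2 - D * (S y z).im ^ 2
  cauchy : ∀ y z, ((S y z).re + (S y z).im * √(D : ℝ)) ^ 2 ≤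
    ((S y y).re + (S y y).im * √(D : ℝ)) * ((S z z).re + (S z z).im * √(D : ℝ))
  cauchy_conj : ∀ y z, ((S y z).re - (S y z).im * √(D : ℝ)) ^ 2 ≤
    ((S y y).re - (S y y).im * √(D : ℝ)) * ((S z z).re - (S z z).im * √(D : ℝ))
  nonneg : ∀ y, 0 ≤ (S y y).re + (S y y).im * √(D : ℝ)
  nonneg_conj : ∀ y, 0 ≤ (S y y).re - (S y y).im * √(D : ℝ)
  det_eq_zero : ∀ x y z, S x x * S y y * S z z + 2 * S x y * S x z * S y z
    - S x x * S y z ^ 2 - S y y * S x z ^ 2 - S z z * S x y ^ 2 = 0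
  universal : ∀ b : ℤ√D, 4 ∣ b.re ^ 2 - D * b.im ^ 2 → 0 < b.re + b.im * √(D : ℝ) →
    0 < b.re - b.im * √(D : ℝ) →
    ∃ (p : ℤ√D) (y : M), 4 ∣ p.re ^ 2 - D * p.im ^ 2 ∧ 2 * S y y = 2 * b - p ^ 2

lemma even_of_four_dvd {D p q : ℤ} (hD : D % 4 = 2 ∨ D % 4 = 3) (h : 4 ∣ p ^ 2 - D * q ^ 2) :
    (∃ p', p = 2 * p') ∧ ∃ q', q = 2 * q' := by
  obtain ⟨d, hd⟩ : ∃ d, D = 4 * d + 2 ∨ D = 4 * d + 3 := ⟨D / 4, by omega⟩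
  obtain ⟨c, hc⟩ := h
  obtain ⟨p', hp⟩ := Int.even_or_odd' p
  obtain ⟨q', hq⟩ := Int.even_or_odd' q
  rcases hp with rfl | rfl <;> rcases hq with rfl | rfl
  · exact ⟨⟨_, rfl⟩, ⟨_, rfl⟩⟩
  all_goals
    exfalso
    rcases hd with rfl | rfl <;> ring_nf at hc <;> omega

lemma parity_of_four_dvd {D p q : ℤ} (hD : D % 4 = 1) (h : 4 ∣ p ^ 2 - D * q ^ 2) :
    p % 2 = q % 2 := by
  obtain ⟨d, rfl⟩ : ∃ d, D = 4 * d + 1 := ⟨D / 4, by omega⟩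
  obtain ⟨c, hc⟩ := h
  obtain ⟨p', hp⟩ := Int.even_or_odd' p
  obtain ⟨q', hq⟩ := Int.even_or_odd' q
  rcases hp with rfl | rfl <;> rcases hq with rfl | rfl
  · omega
  · ring_nf at hc; omega
  · ring_nf at hc; omega
  · omega

lemma eq_zero_of_mul_sq_le {D q n : ℤ} (hn : n < D) (hD : 0 < D) (h : D * q ^ 2 ≤ n) : q = 0 := by
  by_contra hq
  have : 1 ≤ q ^ 2 := by have := sq_pos_of_ne_zero hq; omega
  nlinarith

namespace ComplementData

variable {D : ℤ} (C : ComplementData D)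

lemma exists_represents (hD : 0 < D) (a b : ℤ) (h : 4 ∣ a ^ 2 - D * b ^ 2)
    (h1 : 0 < a + b * √(D : ℝ)) (h2 : 0 < a - b * √(D : ℝ)) :
    ∃ (p q : ℤ) (y : C.M), 4 ∣ p ^ 2 - D * q ^ 2 ∧
      2 * (C.S y y).re = 2 * a - p ^ 2 - D * q ^ 2 ∧ (C.S y y).im = b - p * q ∧
      (p + q * √(D : ℝ)) ^ 2 ≤ 2 * (a + b * √(D : ℝ)) ∧
      (p - q * √(D : ℝ)) ^ 2 ≤ 2 * (a - b * √(D : ℝ)) ∧ p ^ 2 + D * q ^ 2 ≤ 2 * a := by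
  obtain ⟨⟨p, q⟩, y, hp, hy⟩ := C.universal ⟨a, b⟩ h h1 h2
  have hr : √(D : ℝ) ^ 2 = D := Real.sq_sqrt (by exact_mod_cast hD.le)
  have e1 : 2 * (C.S y y).re = 2 * a - p ^ 2 - D * q ^ 2 := by
    have := congrArg Zsqrtd.re hy
    simp [pow_two, Zsqrtd.re_mul] at this
    linarith
  have e2 : (C.S y y).im = b - p * q := by
    have := congrArg Zsqrtd.im hy
    simp [pow_two, Zsqrtd.im_mul] at this
    linarith
  have e1' : 2 * ((C.S y y).re : ℝ) = 2 * a - p ^ 2 - D * q ^ 2 := by exact_mod_cast e1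
  have e2' : ((C.S y y).im : ℝ) = b - p * q := by exact_mod_cast e2
  have n1 := C.nonneg y
  have n2 := C.nonneg_conj y
  rw [e2'] at n1 n2
  have k1 : (p + q * √(D : ℝ)) ^ 2 ≤ 2 * (a + b * √(D : ℝ)) := by nlinarith
  have k2 : (p - q * √(D : ℝ)) ^ 2 ≤ 2 * (a - b * √(D : ℝ)) := by nlinarith
  refine ⟨p, q, y, hp, e1, e2, k1, k2, ?_⟩
  have : (p : ℝ) ^ 2 + D * q ^ 2 ≤ 2 * a := by nlinarith
  exact_mod_cast this

lemma exists_represents_int (hD : 0 < D) (n : ℤ) (hn : 0 < n) :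
    ∃ (p q : ℤ) (y : C.M), 4 ∣ p ^ 2 - D * q ^ 2 ∧
      2 * (C.S y y).re = 4 * n - p ^ 2 - D * q ^ 2 ∧ (C.S y y).im = - (p * q) ∧
      (p + q * √(D : ℝ)) ^ 2 ≤ 4 * n ∧
      (p - q * √(D : ℝ)) ^ 2 ≤ 4 * n ∧ p ^ 2 + D * q ^ 2 ≤ 4 * n := by
  have hn' : (0 : ℝ) < n := by exact_mod_cast hn
  obtain ⟨p, q, y, h1, h2, h3, h4, h5, h6⟩ := C.exists_represents hD (2 * n) 0
    ⟨n ^ 2, by ring⟩ (by push_cast; linarith) (by push_cast; linarith)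
  push_cast at h4 h5
  exact ⟨p, q, y, h1, by linarith, by linarith, by linarith, by linarith, by linarith⟩

lemma sq_add_le (hD : 0 < D) (y z : C.M) :
    (C.S y z).re ^ 2 + D * (C.S y z).im ^ 2 ≤
      (C.S y y).re * (C.S z z).re + D * ((C.S y y).im * (C.S z z).im) := by
  have hr : √(D : ℝ) ^ 2 = D := Real.sq_sqrt (by exact_mod_cast hD.le)
  have h1 := C.cauchy y z
  have h2 := C.cauchy_conj y z
  have : ((C.S y z).re : ℝ) ^ 2 + D * (C.S y z).im ^ 2 ≤
      (C.S y y).re * (C.S z z).re + D * ((C.S y y).im * (C.S z z).im) := by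
    rw [← hr]; linarith
  exact_mod_cast this

lemma gram_rel {n A : ℤ} {f g : C.M} (hf0 : (C.S f f).re = n) (hf1 : (C.S f f).im = 0)
    (hg0 : (C.S f g).re = A) (hg1 : (C.S f g).im = 0) (y : C.M) :
    (n * (C.S g g).re - A ^ 2) *
        (n * (C.S y y).re - (C.S f y).re ^ 2 - D * (C.S f y).im ^ 2) +
      D * (n * (C.S g g).im) * (n * (C.S y y).im - 2 * (C.S f y).re * (C.S f y).im) =
      (n * (C.S g y).re - A * (C.S f y).re) ^ 2 + D * (n * (C.S g y).im - A * (C.S f y).im) ^ 2 ∧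
    (n * (C.S g g).re - A ^ 2) * (n * (C.S y y).im - 2 * (C.S f y).re * (C.S f y).im) +
      n * (C.S g g).im * (n * (C.S y y).re - (C.S f y).re ^ 2 - D * (C.S f y).im ^ 2) =
      2 * (n * (C.S g y).re - A * (C.S f y).re) * (n * (C.S g y).im - A * (C.S f y).im) := by
  have hd := C.det_eq_zero f g y
  have hff : C.S f f = ⟨n, 0⟩ := Zsqrtd.ext hf0 hf1
  have hfg : C.S f g = ⟨A, 0⟩ := Zsqrtd.ext hg0 hg1
  have key : (⟨n, 0⟩ * C.S g g - ⟨A, 0⟩ ^ 2) * (⟨n, 0⟩ * C.S y y - C.S f y ^ 2) =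
      (⟨n, 0⟩ * C.S g y - ⟨A, 0⟩ * C.S f y) ^ 2 := by
    rw [← hff, ← hfg]; linear_combination C.S f f * hd
  constructor
  · have := congrArg Zsqrtd.re key
    simp [pow_two, Zsqrtd.re_mul, Zsqrtd.im_mul] at this
    linarith
  · have := congrArg Zsqrtd.im key
    simp [pow_two, Zsqrtd.re_mul, Zsqrtd.im_mul] at this
    linarith

lemma exists_norm_one_or_two (hD : 0 < D)
    (hq : ∀ p q : ℤ, 4 ∣ p ^ 2 - D * q ^ 2 → p ^ 2 + D * q ^ 2 ≤ 8 → q = 0) :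
    ∃ f : C.M, ((C.S f f).re = 2 ∨ (C.S f f).re = 4) ∧ (C.S f f).im = 0 := by
  obtain ⟨p, q, f, h1, h2, h3, h4, h5, h6⟩ := C.exists_represents_int hD 2 (by norm_num)
  have hq : q = 0 := hq p q h1 h6
  subst hq
  refine ⟨f, ?_, by simpa using h3⟩
  have hp : p ^ 2 ≤ 8 := by linarith
  have : p ≤ 2 := by nlinarith
  have : -2 ≤ p := by nlinarith
  interval_cases p <;> omega

lemma exists_unit_multiple (hD : 6 ≤ D) (hm : D % 4 = 2 ∨ D % 4 = 3) {k : ℤ} (hk : 3 ≤ k)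
    (h1 : (k - 1) ^ 2 < D) (h2 : D < k ^ 2) (e : ℤ) (he : e = 1 ∨ e = -1) :
    ∃ g : C.M, (C.S g g).re = 2 * k ∧ (C.S g g).im = 2 * e := by
  have hr : √(D : ℝ) ^ 2 = D := Real.sq_sqrt (by exact_mod_cast (by omega : 0 ≤ D))
  have hr0 : 0 ≤ √(D : ℝ) := Real.sqrt_nonneg _
  have hk' : (3 : ℝ) ≤ k := by exact_mod_cast hk
  have h1' : ((k : ℝ) - 1) ^ 2 < D := by exact_mod_cast h1
  have h2' : (D : ℝ) < k ^ 2 := by exact_mod_cast h2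
  have hrk : √(D : ℝ) < k := by nlinarith
  have hkr : k - 1 < √(D : ℝ) := by nlinarith
  have h4 : (4 : ℤ) ∣ (2 * k) ^ 2 - D * (2 * e) ^ 2 := ⟨k ^ 2 - D * e ^ 2, by ring⟩
  obtain ⟨p, q, g, a1, a2, a3, a4, a5, a6⟩ := C.exists_represents (by omega) (2 * k) (2 * e) h4
    (by rcases he with rfl | rfl <;> push_cast <;> nlinarith)
    (by rcases he with rfl | rfl <;> push_cast <;> nlinarith)
  obtain ⟨⟨p, rfl⟩, ⟨q, rfl⟩⟩ := even_of_four_dvd hm a1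
  have hq : q = 0 := eq_zero_of_mul_sq_le (D := D) (n := k) (by nlinarith) (by omega)
    (by nlinarith [sq_nonneg p])
  subst hq
  have hp : (p : ℝ) ^ 2 < 1 := by
    push_cast at a4 a5
    rcases he with rfl | rfl
    · push_cast at a5; nlinarith
    · push_cast at a4; nlinarith
  have hp : p ^ 2 < 1 := by exact_mod_cast hp
  have hp : p = 0 := by
    have := sq_nonneg p
    exact pow_eq_zero_iff (two_ne_zero) |>.1 (by omega : p ^ 2 = 0)
  subst hp
  exact ⟨g, by linarith, by linarith⟩

lemma inner_bound (hD : 6 ≤ D) (hm : D % 4 = 2 ∨ D % 4 = 3) {k n : ℤ} (hk : 3 ≤ k)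
    (h1 : (k - 1) ^ 2 < D) (h2 : D < k ^ 2) {f g : C.M} {e : ℤ} (he : e = 1 ∨ e = -1)
    (hn : n = 1 ∨ n = 2) (hf : (C.S f f).re = 2 * n) (hf1 : (C.S f f).im = 0)
    (hg : (C.S g g).re = 2 * k) (hg1 : (C.S g g).im = 2 * e) :
    (C.S f g).im = 0 ∧ ∃ a, (C.S f g).re = 2 * a ∧ a ^ 2 < n := by
  have hr : √(D : ℝ) ^ 2 = D := Real.sq_sqrt (by exact_mod_cast (by omega : 0 ≤ D))
  have hr0 : 0 ≤ √(D : ℝ) := Real.sqrt_nonneg _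
  have hk' : (3 : ℝ) ≤ k := by exact_mod_cast hk
  have h1' : ((k : ℝ) - 1) ^ 2 < D := by exact_mod_cast h1
  have h2' : (D : ℝ) < k ^ 2 := by exact_mod_cast h2
  have hrk : √(D : ℝ) < k := by nlinarith
  have hkr : k - 1 < √(D : ℝ) := by nlinarith
  obtain ⟨⟨a, ha⟩, ⟨b, hb⟩⟩ := even_of_four_dvd hm (C.integral f g)
  have hs := C.sq_add_le (by omega) f g
  have c1 := C.cauchy f g
  have c2 := C.cauchy_conj f g
  rw [hf, hf1, hg, hg1, ha, hb] at hs c1 c2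
  push_cast at c1 c2
  have hs' : a ^ 2 + D * b ^ 2 ≤ n * k := by nlinarith
  have hn0 : (0 : ℝ) < n := by rcases hn with rfl | rfl <;> norm_num
  have hb0 : b = 0 := by
    by_cases hDk : n * k < D
    · exact eq_zero_of_mul_sq_le hDk (by omega) (by nlinarith [sq_nonneg a])
    have hk3 : k = 3 := by rcases hn with rfl | rfl <;> nlinarith
    subst hk3
    have hD6 : D = 6 := by rcases hn with rfl | rfl <;> omega
    subst hD6
    by_contra hb0
    have hb1 : 1 ≤ b ^ 2 := by have := sq_pos_of_ne_zero hb0; omega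
    have ha0 : a ^ 2 = 0 := by have := sq_nonneg a; rcases hn with rfl | rfl <;> omega
    have ha0 : a = 0 := pow_eq_zero_iff (two_ne_zero) |>.1 ha0
    subst ha0
    have hb1' : (1 : ℝ) ≤ b ^ 2 := by exact_mod_cast hb1
    push_cast at *
    rcases he with rfl | rfl <;> rcases hn with rfl | rfl <;> push_cast at * <;> nlinarith
  subst hb0
  refine ⟨by simpa using hb, a, ha, ?_⟩
  have : (a : ℝ) ^ 2 < n := by
    push_cast at c1 c2
    rcases he with rfl | rfl
    · push_cast at c2; nlinarith
    · push_cast at c1; nlinarith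
  exact_mod_cast this

lemma false_of_norm_one (hD : 6 ≤ D) (hm : D % 4 = 2 ∨ D % 4 = 3) {k : ℤ} (hk : 3 ≤ k)
    (h1 : (k - 1) ^ 2 < D) (h2 : D < k ^ 2) {f : C.M}
    (hf : (C.S f f).re = 2) (hf1 : (C.S f f).im = 0) : False := by
  obtain ⟨g, hg, hg1⟩ := C.exists_unit_multiple hD hm hk h1 h2 1 (.inl rfl)
  obtain ⟨hfg1, a, hfg, ha⟩ := C.inner_bound (n := 1) hD hm hk h1 h2 (.inl rfl) (.inl rfl)
    hf hf1 hg hg1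
  have ha : a = 0 := pow_eq_zero_iff (two_ne_zero) |>.1 (by have := sq_nonneg a; omega)
  subst ha
  obtain ⟨p, q, w, a1, a2, a3, a4, a5, a6⟩ := C.exists_represents_int (by omega) 3 (by norm_num)
  obtain ⟨⟨p, rfl⟩, ⟨q, rfl⟩⟩ := even_of_four_dvd hm a1
  have hq : q = 0 := eq_zero_of_mul_sq_le (D := D) (n := 3) (by omega) (by omega)
    (by nlinarith [sq_nonneg p])
  subst hq
  obtain ⟨⟨h, hh⟩, ⟨h', hh'⟩⟩ := even_of_four_dvd hm (C.integral f w)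
  obtain ⟨⟨c, hc⟩, ⟨c', hc'⟩⟩ := even_of_four_dvd hm (C.integral g w)
  have hs := C.sq_add_le (by omega) f w
  rw [hf, hf1, hh, hh'] at hs
  have : h' = 0 := eq_zero_of_mul_sq_le (D := D) (n := 3) (by omega) (by omega)
    (by nlinarith [sq_nonneg p, sq_nonneg h])
  subst this
  obtain ⟨r1, r2⟩ := C.gram_rel hf hf1 (by simpa using hfg) hfg1 w
  rw [hg, hg1, hh, hh', hc, hc', a3] at r1 r2
  have hw : (C.S w w).re = 6 - 2 * p ^ 2 := by linarith
  rw [hw] at r1 r2 hs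
  have p1 : p ≤ 1 := by nlinarith
  have p2 : -1 ≤ p := by nlinarith
  have q1 : h ≤ 1 := by nlinarith [sq_nonneg p]
  have q2 : -1 ≤ h := by nlinarith [sq_nonneg p]
  have r2' : c * c' * 2 = 3 - p ^ 2 - h ^ 2 := by linarith
  have r1' : (c ^ 2 + D * c' ^ 2) = (3 - p ^ 2 - h ^ 2) * k := by linarith
  obtain ⟨e1, e2⟩ : c * c' = 1 ∧ 3 - p ^ 2 - h ^ 2 = 2 := by
    interval_cases p <;> interval_cases h <;> omega
  rw [e2] at r1'
  have hDk : 1 + D = 2 * k := by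
    rcases Int.mul_eq_one_iff_eq_one_or_neg_one.1 e1 with ⟨rfl, rfl⟩ | ⟨rfl, rfl⟩ <;> linarith
  clear * - hDk h1 hk hD
  have : k < 4 := by nlinarith
  omega

end ComplementData

lemma false_of_disc_eq {D k a u c : ℤ} (hD : 10 < D) (hm : D % 4 = 2 ∨ D % 4 = 3) (hk : 3 ≤ k)
    (h1 : (k - 1) ^ 2 < D) (h2 : D < k ^ 2) (ha1 : a ≤ 1) (ha2 : -1 ≤ a)
    (huc : u * c = 2 ∨ u * c = 3 ∨ u * c = 4 ∨ u * c = 5)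
    (h : (2 * k - a ^ 2) * (u * c * 2) = u ^ 2 + D * (2 * c) ^ 2) : False := by
  have hn0 : 0 ≤ u * c := by omega
  have hk5 : k * (u * c) < 4 * D := by
    have : k * (u * c) ≤ k * 5 := mul_le_mul_of_nonneg_left (by omega) (by omega)
    nlinarith
  have hDc : D * c ^ 2 ≤ k * (u * c) := by nlinarith [mul_nonneg (sq_nonneg a) hn0, sq_nonneg u]
  have hc2 : c ^ 2 < 4 := by
    by_contra! hc
    have : D * 4 ≤ D * c ^ 2 := mul_le_mul_of_nonneg_left hc (by omega)
    omega
  have hc0 : c ≠ 0 := by rintro rfl; omega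
  have hc3 : c = 1 ∨ c = -1 := by
    have : c < 2 := by nlinarith
    have : -2 < c := by nlinarith
    omega
  have r3 : (2 * k - a ^ 2) * (2 * (u * c)) = (u * c) ^ 2 + 4 * D := by
    rcases hc3 with rfl | rfl <;> linear_combination h
  generalize u * c = n at *
  clear * - r3 huc h1 h2 hD hm hk ha1 ha2
  have hk4 : k = 3 ∨ k = 4 ∨ 5 ≤ k := by omega
  have h5 : 5 ≤ k → k * 4 - 4 ≤ (k - 1) ^ 2 := by intro; nlinarith
  have ha : a ^ 2 = 0 ∨ a ^ 2 = 1 := by interval_cases a <;> simp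
  rcases huc with rfl | rfl | rfl | rfl <;> rcases ha with ha | ha <;> rw [ha] at r3 <;>
    rcases hk4 with rfl | rfl | hk4 <;> omega

namespace ComplementData

variable {D : ℤ} (C : ComplementData D)

lemma exists_norm_four_or_five (hD : 0 < D) (h1 : ∀ y : C.M, (C.S y y).im = 0 → (C.S y y).re ≠ 2)
    (hq : ∀ p q : ℤ, 4 ∣ p ^ 2 - D * q ^ 2 → (p + q * √(D : ℝ)) ^ 2 ≤ 20 →
      (p - q * √(D : ℝ)) ^ 2 ≤ 20 → q = 0) :
    ∃ v : C.M, ((C.S v v).re = 8 ∨ (C.S v v).re = 10) ∧ (C.S v v).im = 0 := by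
  obtain ⟨p, q, v, a1, a2, a3, a4, a5, a6⟩ := C.exists_represents_int hD 5 (by norm_num)
  have hq : q = 0 := hq p q a1 (by norm_num at a4; exact a4) (by norm_num at a5; exact a5)
  subst hq
  have a3 : (C.S v v).im = 0 := by simpa using a3
  have h1 := h1 v a3
  refine ⟨v, ?_, a3⟩
  have hp : p ^ 2 ≤ 20 := by linarith
  have : p ≤ 4 := by nlinarith
  have : -4 ≤ p := by nlinarith
  interval_cases p <;> omega

lemma false_of_norm_two (hD : 10 < D) (hm : D % 4 = 2 ∨ D % 4 = 3) {k : ℤ} (hk : 3 ≤ k)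
    (h1 : (k - 1) ^ 2 < D) (h2 : D < k ^ 2)
    (hne : ∀ y : C.M, (C.S y y).im = 0 → (C.S y y).re ≠ 2) {f : C.M}
    (hf : (C.S f f).re = 4) (hf1 : (C.S f f).im = 0) : False := by
  have hr : √(D : ℝ) ^ 2 = D := Real.sq_sqrt (by exact_mod_cast (by omega : 0 ≤ D))
  obtain ⟨g, hg, hg1⟩ := C.exists_unit_multiple (by omega) hm hk h1 h2 1 (.inl rfl)
  obtain ⟨hfg1, a, hfg, ha⟩ := C.inner_bound (n := 2) (by omega) hm hk h1 h2 (.inl rfl) (.inr rfl)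
    hf hf1 hg hg1
  obtain ⟨v, hv, hv1⟩ := C.exists_norm_four_or_five (by omega) hne (fun p q a1 a2 a3 => by
    obtain ⟨⟨p, rfl⟩, ⟨q, rfl⟩⟩ := even_of_four_dvd hm a1
    have : (p : ℝ) ^ 2 + D * q ^ 2 ≤ 5 := by push_cast at a2 a3; nlinarith
    have : p ^ 2 + D * q ^ 2 ≤ 5 := by exact_mod_cast this
    have := eq_zero_of_mul_sq_le (D := D) (q := q) (n := 5) (by omega) (by omega)
      (by nlinarith [sq_nonneg p])
    omega)
  obtain ⟨q, hq, hv⟩ : ∃ q, (q = 4 ∨ q = 5) ∧ (C.S v v).re = 2 * q := by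
    rcases hv with hv | hv
    · exact ⟨4, .inl rfl, hv⟩
    · exact ⟨5, .inr rfl, hv⟩
  obtain ⟨⟨h, hh⟩, ⟨h', hh'⟩⟩ := even_of_four_dvd hm (C.integral f v)
  obtain ⟨⟨c, hc⟩, ⟨c', hc'⟩⟩ := even_of_four_dvd hm (C.integral g v)
  have hs := C.sq_add_le (by omega) f v
  rw [hf, hf1, hv, hv1, hh, hh'] at hs
  have hs' : h ^ 2 + D * h' ^ 2 ≤ 2 * q := by linarith
  have : h' = 0 := eq_zero_of_mul_sq_le (D := D) (n := 10) (by omega) (by omega)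
    (by have := sq_nonneg h; omega)
  subst this
  obtain ⟨r1, r2⟩ := C.gram_rel hf hf1 hfg hfg1 v
  rw [hg, hg1, hh, hh', hc, hc', hv, hv1] at r1 r2
  have r2' : (2 * c - a * h) * c' * 2 = 2 * q - h ^ 2 := by linarith
  have r1' : (2 * k - a ^ 2) * (2 * q - h ^ 2) = (2 * c - a * h) ^ 2 + D * (2 * c') ^ 2 := by
    linarith
  clear r1 r2 hs hh hh' hc hc' hfg hg
  have hq3 : h ≤ 3 := by rcases hq with rfl | rfl <;> nlinarith
  have hq4 : -3 ≤ h := by rcases hq with rfl | rfl <;> nlinarith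
  have ha1 : a ≤ 1 := by nlinarith
  have ha2 : -1 ≤ a := by nlinarith
  have ha3 : 0 ≤ a ^ 2 := sq_nonneg a
  generalize hu : 2 * c - a * h = u at *
  have hpos : 1 ≤ 2 * q - h ^ 2 := by
    rcases hq with rfl | rfl <;> interval_cases h <;> omega
  generalize hΔ : 2 * q - h ^ 2 = Δ at *
  have hc0 : c' ≠ 0 := by rintro rfl; omega
  have hc1 : 1 ≤ c' ^ 2 := by have := sq_pos_of_ne_zero hc0; omega
  have huc : u * c' = 2 ∨ u * c' = 3 ∨ u * c' = 4 ∨ u * c' = 5 := by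
    rcases hq with rfl | rfl <;> interval_cases h <;> omega
  exact false_of_disc_eq hD hm hk h1 h2 ha1 ha2 huc
    (by linear_combination r1' + (2 * k - a ^ 2) * r2')

end ComplementData

lemma sq_eq_one_of_gram {D k a s w c : ℤ} (hD : D = 6 ∧ k = 3 ∨ D = 7 ∧ k = 3 ∨ D = 10 ∧ k = 4)
    (ha : a ^ 2 < 2) (hs : s ^ 2 < 2)
    (h1 : (2 * k - a ^ 2) * (2 * k - s ^ 2) - 4 * D = w ^ 2 + 4 * (D * c ^ 2))
    (h2 : a ^ 2 - s ^ 2 = 2 * (w * c)) : D ≠ 7 ∧ (a = 1 ∨ a = -1) := by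
  have ha' : a = 0 ∨ a = 1 ∨ a = -1 := by
    have : a < 2 := by nlinarith
    have : -2 < a := by nlinarith
    omega
  have ha2 : a ^ 2 = 0 ∨ a ^ 2 = 1 := by have := sq_nonneg a; omega
  have hs2 : s ^ 2 = 0 ∨ s ^ 2 = 1 := by have := sq_nonneg s; omega
  have has : a ^ 2 = s ^ 2 := by omega
  rw [← has] at h1
  have hw0 := sq_nonneg w
  have hc0 : c = 0 := by
    apply eq_zero_of_mul_sq_le (D := D) (n := D - 1) (by omega) (by omega)
    rcases ha2 with ha2 | ha2 <;> rw [ha2] at h1 <;>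
    rcases hD with ⟨rfl, rfl⟩ | ⟨rfl, rfl⟩ | ⟨rfl, rfl⟩ <;> omega
  subst hc0
  have hw : w ^ 2 < 5 ^ 2 := by
    rcases ha2 with ha2 | ha2 <;> rw [ha2] at h1 <;>
    rcases hD with ⟨rfl, rfl⟩ | ⟨rfl, rfl⟩ | ⟨rfl, rfl⟩ <;> omega
  obtain ⟨l1, l2⟩ := abs_lt_of_sq_lt_sq' hw (by norm_num)
  rcases hD with ⟨rfl, rfl⟩ | ⟨rfl, rfl⟩ | ⟨rfl, rfl⟩ <;> rcases ha' with rfl | rfl | rfl <;>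
    interval_cases w <;> omega

namespace ComplementData

variable {D : ℤ} (C : ComplementData D)

lemma exists_inner_sq_eq_one {k : ℤ} (hD : D = 6 ∧ k = 3 ∨ D = 7 ∧ k = 3 ∨ D = 10 ∧ k = 4) {f : C.M}
    (hf : (C.S f f).re = 4) (hf1 : (C.S f f).im = 0) :
    D ≠ 7 ∧ ∃ g : C.M, (C.S g g).re = 2 * k ∧ (C.S g g).im = 2 ∧ (C.S f g).im = 0 ∧
      ((C.S f g).re = 2 ∨ (C.S f g).re = -2) := by
  have hD6 : 6 ≤ D := by omega
  have hm : D % 4 = 2 ∨ D % 4 = 3 := by omega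
  have hk : 3 ≤ k := by omega
  have h1 : (k - 1) ^ 2 < D := by rcases hD with ⟨rfl, rfl⟩ | ⟨rfl, rfl⟩ | ⟨rfl, rfl⟩ <;> norm_num
  have h2 : D < k ^ 2 := by rcases hD with ⟨rfl, rfl⟩ | ⟨rfl, rfl⟩ | ⟨rfl, rfl⟩ <;> norm_num
  obtain ⟨g, hg, hg1⟩ := C.exists_unit_multiple hD6 hm hk h1 h2 1 (.inl rfl)
  obtain ⟨y, hy, hy1⟩ := C.exists_unit_multiple hD6 hm hk h1 h2 (-1) (.inr rfl)
  obtain ⟨hfg1, a, hfg, ha⟩ := C.inner_bound (n := 2) hD6 hm hk h1 h2 (.inl rfl) (.inr rfl)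
    hf hf1 hg hg1
  obtain ⟨hfy1, s, hfy, hs⟩ := C.inner_bound (n := 2) hD6 hm hk h1 h2 (.inr rfl) (.inr rfl)
    hf hf1 hy hy1
  obtain ⟨⟨c, hc⟩, ⟨c', hc'⟩⟩ := even_of_four_dvd hm (C.integral g y)
  obtain ⟨r1, r2⟩ := C.gram_rel hf hf1 hfg hfg1 y
  rw [hg, hg1, hfy, hfy1, hc, hc', hy, hy1] at r1 r2
  have r1' : (2 * k - a ^ 2) * (2 * k - s ^ 2) - 4 * D =
      (2 * c - a * s) ^ 2 + 4 * (D * c' ^ 2) := by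
    linarith
  have r2' : a ^ 2 - s ^ 2 = 2 * ((2 * c - a * s) * c') := by linarith
  have key : D ≠ 7 ∧ (a = 1 ∨ a = -1) := sq_eq_one_of_gram hD ha hs r1' r2'
  refine ⟨key.1, g, hg, by linarith, hfg1, ?_⟩
  rcases key.2 with rfl | rfl <;> simp [hfg]

end ComplementData

lemma false_of_gram_six {s₀ s₁ A B : ℤ} (hs : s₀ ^ 2 + 6 * s₁ ^ 2 ≤ 10)
    (h1 : 5 * (10 - s₀ ^ 2 - 6 * s₁ ^ 2) + 24 * (2 - s₀ * s₁) = A ^ 2 + 6 * B ^ 2)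
    (h2 : 5 * (2 - s₀ * s₁) + (10 - s₀ ^ 2 - 6 * s₁ ^ 2) = A * B)
    (hA : A % 2 = s₀ % 2) (hB : B % 2 = s₁ % 2) : False := by
  have b1 : s₀ ≤ 3 := by nlinarith
  have b2 : -3 ≤ s₀ := by nlinarith
  have b3 : s₁ ≤ 1 := by nlinarith
  have b4 : -1 ≤ s₁ := by nlinarith
  have hle : A ^ 2 + 6 * B ^ 2 < 14 ^ 2 := by rw [← h1]; nlinarith
  have c1 : B ≤ 5 := by nlinarith
  have c2 : -5 ≤ B := by nlinarith
  have c3 : A ≤ 13 := by nlinarith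
  have c4 : -13 ≤ A := by nlinarith
  have key : ∀ s₀ ∈ Finset.Icc (-3 : ℤ) 3, ∀ s₁ ∈ Finset.Icc (-1 : ℤ) 1,
      ∀ B ∈ Finset.Icc (-5 : ℤ) 5, B % 2 = s₁ % 2 → ∀ A ∈ Finset.Icc (-13 : ℤ) 13,
      s₀ ^ 2 + 6 * s₁ ^ 2 ≤ 10 →
      5 * (2 - s₀ * s₁) + (10 - s₀ ^ 2 - 6 * s₁ ^ 2) = A * B →
      5 * (10 - s₀ ^ 2 - 6 * s₁ ^ 2) + 24 * (2 - s₀ * s₁) = A ^ 2 + 6 * B ^ 2 →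
      A % 2 ≠ s₀ % 2 := by
    decide +kernel
  exact key s₀ (by simp [b1, b2]) s₁ (by simp [b3, b4]) B (by simp [c1, c2]) hB A
    (by simp [c3, c4]) hs h2 h1 hA

lemma false_of_gram_ten {m s₀ s₁ A B : ℤ} (hm : m = 12 ∨ m = 10)
    (hs : s₀ ^ 2 + 10 * s₁ ^ 2 ≤ m)
    (h1 : 7 * (m - s₀ ^ 2 - 10 * s₁ ^ 2) + 40 * (1 - s₀ * s₁) = A ^ 2 + 10 * B ^ 2)
    (h2 : 7 * (1 - s₀ * s₁) + (m - s₀ ^ 2 - 10 * s₁ ^ 2) = A * B)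
    (hA : A % 2 = s₀ % 2) (hB : B % 2 = s₁ % 2) : False := by
  have hm' : m ≤ 12 := by omega
  have hs' : s₀ ^ 2 + 10 * s₁ ^ 2 ≤ 12 := by omega
  have b1 : s₀ ≤ 3 := by nlinarith
  have b2 : -3 ≤ s₀ := by nlinarith
  have b3 : s₁ ≤ 1 := by nlinarith
  have b4 : -1 ≤ s₁ := by nlinarith
  have hle : A ^ 2 + 10 * B ^ 2 < 16 ^ 2 := by
    rw [← h1]; nlinarith [sq_nonneg (s₀ + 3 * s₁), sq_nonneg s₀, sq_nonneg s₁]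
  have c1 : B ≤ 5 := by nlinarith
  have c2 : -5 ≤ B := by nlinarith
  have c3 : A ≤ 15 := by nlinarith
  have c4 : -15 ≤ A := by nlinarith
  have key : ∀ m ∈ ({12, 10} : Finset ℤ), ∀ s₀ ∈ Finset.Icc (-3 : ℤ) 3,
      ∀ s₁ ∈ Finset.Icc (-1 : ℤ) 1,
      ∀ B ∈ Finset.Icc (-5 : ℤ) 5, B % 2 = s₁ % 2 → ∀ A ∈ Finset.Icc (-15 : ℤ) 15,
      s₀ ^ 2 + 10 * s₁ ^ 2 ≤ m →
      7 * (1 - s₀ * s₁) + (m - s₀ ^ 2 - 10 * s₁ ^ 2) = A * B →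
      7 * (m - s₀ ^ 2 - 10 * s₁ ^ 2) + 40 * (1 - s₀ * s₁) = A ^ 2 + 10 * B ^ 2 →
      A % 2 ≠ s₀ % 2 := by
    decide +kernel
  exact key m (by simpa using hm) s₀ (by simp [b1, b2]) s₁ (by simp [b3, b4]) B (by simp [c1, c2])
    hB A (by simp [c3, c4]) hs h2 h1 hA

namespace ComplementData

lemma false_of_six (C : ComplementData 6) {f : C.M}
    (hf : (C.S f f).re = 4) (hf1 : (C.S f f).im = 0) : False := by
  have hm : (6 : ℤ) % 4 = 2 ∨ (6 : ℤ) % 4 = 3 := by norm_num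
  obtain ⟨-, g, hg, hg1, hfg1, hfg⟩ := C.exists_inner_sq_eq_one (k := 3) (by norm_num) hf hf1
  have hr : √((6 : ℤ) : ℝ) ^ 2 = 6 := by rw [Real.sq_sqrt] <;> norm_num
  have hr0 : 0 ≤ √((6 : ℤ) : ℝ) := Real.sqrt_nonneg _
  have hr1 : √((6 : ℤ) : ℝ) < 2.5 := (Real.sqrt_lt' (by norm_num)).2 (by norm_num)
  have hr2 : 2.4 < √((6 : ℤ) : ℝ) := Real.lt_sqrt_of_sq_lt (by norm_num)
  obtain ⟨p, q, y, a1, a2, a3, a4, a5, a6⟩ := C.exists_represents (by norm_num) 10 4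
    (by norm_num) (by push_cast at *; linarith) (by push_cast at *; linarith)
  obtain ⟨⟨p, rfl⟩, ⟨q, rfl⟩⟩ := even_of_four_dvd hm a1
  have hq : q = 0 := eq_zero_of_mul_sq_le (D := 6) (n := 5) (by omega) (by omega)
    (by nlinarith [sq_nonneg p])
  subst hq
  have hp : (p : ℝ) ^ 2 < 1 := by push_cast at *; nlinarith
  have hp : p ^ 2 < 1 := by exact_mod_cast hp
  have hp : p = 0 := pow_eq_zero_iff (two_ne_zero) |>.1 (by have := sq_nonneg p; omega)
  subst hp
  obtain ⟨⟨s, hs⟩, ⟨s', hs'⟩⟩ := even_of_four_dvd hm (C.integral f y)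
  obtain ⟨⟨t, ht⟩, ⟨t', ht'⟩⟩ := even_of_four_dvd hm (C.integral g y)
  have hy : (C.S y y).re = 10 := by linarith
  have hy1 : (C.S y y).im = 4 := by linarith
  have hb := C.sq_add_le (by norm_num) f y
  rw [hf, hf1, hs, hs', hy, hy1] at hb
  have hb : s ^ 2 + 6 * s' ^ 2 ≤ 10 := by linarith
  rcases hfg with hfg | hfg
  · obtain ⟨r1, r2⟩ := C.gram_rel hf hf1 hfg hfg1 y
    rw [hg, hg1, hs, hs', ht, ht', hy, hy1] at r1 r2
    exact false_of_gram_six (A := 2 * t - s) (B := 2 * t' - s') hb (by linarith) (by linarith)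
      (by omega) (by omega)
  · obtain ⟨r1, r2⟩ := C.gram_rel hf hf1 hfg hfg1 y
    rw [hg, hg1, hs, hs', ht, ht', hy, hy1] at r1 r2
    exact false_of_gram_six (A := 2 * t + s) (B := 2 * t' + s') hb (by linarith) (by linarith)
      (by omega) (by omega)

lemma false_of_ten (C : ComplementData 10) {f : C.M}
    (hf : (C.S f f).re = 4) (hf1 : (C.S f f).im = 0) : False := by
  have hm : (10 : ℤ) % 4 = 2 ∨ (10 : ℤ) % 4 = 3 := by norm_num
  obtain ⟨-, g, hg, hg1, hfg1, hfg⟩ := C.exists_inner_sq_eq_one (k := 4) (by norm_num) hf hf1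
  have hr : √((10 : ℤ) : ℝ) ^ 2 = 10 := by rw [Real.sq_sqrt] <;> norm_num
  have hr0 : 0 ≤ √((10 : ℤ) : ℝ) := Real.sqrt_nonneg _
  have hr1 : √((10 : ℤ) : ℝ) < 3.2 := (Real.sqrt_lt' (by norm_num)).2 (by norm_num)
  have hr2 : 3 < √((10 : ℤ) : ℝ) := Real.lt_sqrt_of_sq_lt (by norm_num)
  obtain ⟨p, q, y, a1, a2, a3, a4, a5, a6⟩ := C.exists_represents (by norm_num) 12 2
    (by norm_num) (by push_cast at *; linarith) (by push_cast at *; linarith)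
  obtain ⟨⟨p, rfl⟩, ⟨q, rfl⟩⟩ := even_of_four_dvd hm a1
  have hq : q = 0 := eq_zero_of_mul_sq_le (D := 10) (n := 6) (by omega) (by omega)
    (by nlinarith [sq_nonneg p])
  subst hq
  have hp : (p : ℝ) ^ 2 < 4 := by push_cast at *; nlinarith
  have hp : p ^ 2 < 2 ^ 2 := by norm_num; exact_mod_cast hp
  have hm' : 12 - 2 * p ^ 2 = 12 ∨ 12 - 2 * p ^ 2 = 10 := by
    obtain ⟨l1, l2⟩ := abs_lt_of_sq_lt_sq' hp (by norm_num)
    interval_cases p <;> omega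
  obtain ⟨⟨s, hs⟩, ⟨s', hs'⟩⟩ := even_of_four_dvd hm (C.integral f y)
  obtain ⟨⟨t, ht⟩, ⟨t', ht'⟩⟩ := even_of_four_dvd hm (C.integral g y)
  have hy : (C.S y y).re = 12 - 2 * p ^ 2 := by linarith
  have hy1 : (C.S y y).im = 2 := by linarith
  have hb := C.sq_add_le (by norm_num) f y
  rw [hf, hf1, hs, hs', hy, hy1] at hb
  have hb : s ^ 2 + 10 * s' ^ 2 ≤ 12 - 2 * p ^ 2 := by linarith
  rcases hfg with hfg | hfg
  · obtain ⟨r1, r2⟩ := C.gram_rel hf hf1 hfg hfg1 y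
    rw [hg, hg1, hs, hs', ht, ht', hy, hy1] at r1 r2
    exact false_of_gram_ten (A := 2 * t - s) (B := 2 * t' - s') hm' hb (by linarith) (by linarith)
      (by omega) (by omega)
  · obtain ⟨r1, r2⟩ := C.gram_rel hf hf1 hfg hfg1 y
    rw [hg, hg1, hs, hs', ht, ht', hy, hy1] at r1 r2
    exact false_of_gram_ten (A := 2 * t + s) (B := 2 * t' + s') hm' hb (by linarith) (by linarith)
      (by omega) (by omega)

lemma false_of_mod_four_ne_one {D : ℤ} (C : ComplementData D) (hD : 6 ≤ D)
    (hm : D % 4 = 2 ∨ D % 4 = 3) {k : ℤ} (h1 : (k - 1) ^ 2 < D) (h2 : D < k ^ 2) :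
    False := by
  have hk : 3 ≤ k := by nlinarith
  obtain ⟨f, hf | hf, hf1⟩ := C.exists_norm_one_or_two (by omega) (fun p q a1 a2 => by
    obtain ⟨⟨p, rfl⟩, ⟨q, rfl⟩⟩ := even_of_four_dvd hm a1
    have := eq_zero_of_mul_sq_le (D := D) (q := q) (n := 2) (by omega) (by omega)
      (by nlinarith [sq_nonneg p])
    omega)
  · exact C.false_of_norm_one hD hm hk h1 h2 hf hf1
  · by_cases hD10 : 10 < D
    · exact C.false_of_norm_two hD10 hm hk h1 h2
        (fun y hy1 hy => C.false_of_norm_one hD hm hk h1 h2 hy hy1) hf hf1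
    obtain rfl | rfl | rfl : D = 6 ∨ D = 7 ∨ D = 10 := by omega
    · exact C.false_of_six hf hf1
    · exact (C.exists_inner_sq_eq_one (k := 3) (by norm_num) hf hf1).1 rfl
    · exact C.false_of_ten hf hf1

variable {D : ℤ} (C : ComplementData D)

lemma exists_half_unit_multiple (hD : 13 ≤ D) (hm : D % 4 = 1) {m : ℤ} (hmo : m % 2 = 1)
    (h1 : (m - 2) ^ 2 < D) (h2 : D < m ^ 2) (hm5 : 5 ≤ m) (e : ℤ) (he : e = 1 ∨ e = -1) :
    ∃ g : C.M, (C.S g g).re = m ∧ (C.S g g).im = e := by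
  have hr : √(D : ℝ) ^ 2 = D := Real.sq_sqrt (by exact_mod_cast (by omega : 0 ≤ D))
  have hr0 : 0 ≤ √(D : ℝ) := Real.sqrt_nonneg _
  have hk' : (5 : ℝ) ≤ m := by exact_mod_cast hm5
  have h1' : ((m : ℝ) - 2) ^ 2 < D := by exact_mod_cast h1
  have h2' : (D : ℝ) < m ^ 2 := by exact_mod_cast h2
  have hrk : √(D : ℝ) < m := by nlinarith
  have hkr : m - 2 < √(D : ℝ) := by nlinarith
  have h4 : (4 : ℤ) ∣ m ^ 2 - D * e ^ 2 := by
    obtain ⟨d, rfl⟩ : ∃ d, D = 4 * d + 1 := ⟨D / 4, by omega⟩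
    obtain ⟨n, rfl⟩ : ∃ n, m = 2 * n + 1 := ⟨m / 2, by omega⟩
    have : e ^ 2 = 1 := by rcases he with rfl | rfl <;> rfl
    rw [this]
    exact ⟨n ^ 2 + n - d, by ring⟩
  obtain ⟨p, q, g, a1, a2, a3, a4, a5, a6⟩ := C.exists_represents (by omega) m e h4
    (by rcases he with rfl | rfl <;> push_cast <;> linarith)
    (by rcases he with rfl | rfl <;> push_cast <;> linarith)
  have hpar := parity_of_four_dvd hm a1
  have hq : q = 0 := by
    refine eq_zero_of_mul_sq_le (D := D) (n := 2 * m) ?_ (by omega) (by nlinarith [sq_nonneg p])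
    by_cases hm7 : m ≤ 6
    · obtain rfl : m = 5 := by omega
      omega
    · nlinarith
  subst hq
  have hp : (p : ℝ) ^ 2 < 4 := by
    rcases he with rfl | rfl
    · push_cast at a5; nlinarith
    · push_cast at a4; nlinarith
  have hp : p ^ 2 < 2 ^ 2 := by norm_num; exact_mod_cast hp
  obtain ⟨l1, l2⟩ := abs_lt_of_sq_lt_sq' hp (by norm_num)
  obtain rfl : p = 0 := by omega
  exact ⟨g, by linarith, by linarith⟩

lemma half_inner_bound (hD : 13 ≤ D) (hm : D % 4 = 1) {m n : ℤ} (hmo : m % 2 = 1)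
    (h1 : (m - 2) ^ 2 < D) (h2 : D < m ^ 2) (hm5 : 5 ≤ m) {f g : C.M} {e : ℤ}
    (he : e = 1 ∨ e = -1)
    (hn : n = 1 ∨ n = 2) (hf : (C.S f f).re = 2 * n) (hf1 : (C.S f f).im = 0)
    (hg : (C.S g g).re = m) (hg1 : (C.S g g).im = e) :
    (C.S f g).im = 0 ∧ ∃ a, (C.S f g).re = 2 * a ∧ 2 * a ^ 2 ≤ n * (m - √(D : ℝ)) := by
  have hr : √(D : ℝ) ^ 2 = D := Real.sq_sqrt (by exact_mod_cast (by omega : 0 ≤ D))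
  have hr0 : 0 ≤ √(D : ℝ) := Real.sqrt_nonneg _
  have hk' : (5 : ℝ) ≤ m := by exact_mod_cast hm5
  have h1' : ((m : ℝ) - 2) ^ 2 < D := by exact_mod_cast h1
  have h2' : (D : ℝ) < m ^ 2 := by exact_mod_cast h2
  have hrk : √(D : ℝ) < m := by nlinarith
  have hkr : m - 2 < √(D : ℝ) := by nlinarith
  have hpar := parity_of_four_dvd hm (C.integral f g)
  have hs := C.sq_add_le (by omega) f g
  have c1 := C.cauchy f g
  have c2 := C.cauchy_conj f g
  rw [hf, hf1, hg, hg1] at hs c1 c2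
  push_cast at c1 c2
  generalize (C.S f g).re = a at *
  generalize (C.S f g).im = b at *
  have hs' : a ^ 2 + D * b ^ 2 ≤ 2 * n * m := by nlinarith
  have hn0 : (0 : ℝ) < n := by rcases hn with rfl | rfl <;> norm_num
  have hb0 : b = 0 := by
    by_cases hDk : 2 * n * m < D
    · exact eq_zero_of_mul_sq_le (D := D) hDk (by omega) (by nlinarith [sq_nonneg a])
    have hDm : D ≤ 4 * m := by rcases hn with rfl | rfl <;> omega
    have hm7 : m < 8 := by nlinarith
    obtain rfl | rfl : m = 5 ∨ m = 7 := by omega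
    swap
    · omega
    by_contra hb0
    have hb1 : 1 ≤ b ^ 2 := by have := sq_pos_of_ne_zero hb0; omega
    have hab : a ^ 2 + D * b ^ 2 ≤ 20 := by rcases hn with rfl | rfl <;> omega
    have hb2 : b ^ 2 < 2 ^ 2 := by nlinarith [sq_nonneg a]
    obtain ⟨l1, l2⟩ := abs_lt_of_sq_lt_sq' hb2 (by norm_num)
    have ha2 : a ^ 2 < 3 ^ 2 := by nlinarith
    obtain ⟨l3, l4⟩ := abs_lt_of_sq_lt_sq' ha2 (by norm_num)
    have ha : a = 1 ∨ a = -1 := by omega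
    have hb : b = 1 ∨ b = -1 := by omega
    have hD' : (13 : ℝ) ≤ D := by exact_mod_cast hD
    have hr3 : 3.5 < √(D : ℝ) := Real.lt_sqrt_of_sq_lt (by norm_num; linarith)
    have hn2 : (n : ℝ) ≤ 2 := by rcases hn with rfl | rfl <;> norm_num
    have hup : 2 * n * (5 - √(D : ℝ)) ≤ 4 * (5 - √(D : ℝ)) := by
      push_cast at hrk
      nlinarith
    have hlow : (√(D : ℝ) - 1) ^ 2 ≤ 2 * n * (5 - √(D : ℝ)) := by
      push_cast at c1 c2
      rcases he with rfl | rfl <;> rcases ha with rfl | rfl <;> rcases hb with rfl | rfl <;>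
        push_cast at c1 c2 <;> linarith
    linarith
  subst hb0
  obtain ⟨a, rfl⟩ : ∃ a', a = 2 * a' := ⟨a / 2, by omega⟩
  refine ⟨rfl, a, rfl, ?_⟩
  push_cast at c1 c2
  rcases he with rfl | rfl
  · push_cast at c2; linarith
  · push_cast at c1; linarith

end ComplementData

lemma im_eq_zero_of_sq_le {D p q : ℤ} {N : ℝ} (hD : 13 ≤ D) (hm : D % 4 = 1)
    (h : 4 ∣ p ^ 2 - D * q ^ 2) (h1 : (p + q * √(D : ℝ)) ^ 2 ≤ N)
    (h2 : (p - q * √(D : ℝ)) ^ 2 ≤ N) (hN : N < D + 1 + 2 * √(D : ℝ)) : q = 0 := by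
  have hr : √(D : ℝ) ^ 2 = D := Real.sq_sqrt (by exact_mod_cast (by omega : 0 ≤ D))
  have hD' : (13 : ℝ) ≤ D := by exact_mod_cast hD
  have hr3 : 3.5 < √(D : ℝ) := Real.lt_sqrt_of_sq_lt (by norm_num; linarith)
  by_contra hq
  have hpar := parity_of_four_dvd hm h
  have hq1 : 1 ≤ q ^ 2 := by have := sq_pos_of_ne_zero hq; omega
  have hq1' : (1 : ℝ) ≤ q ^ 2 := by exact_mod_cast hq1
  have hsum : (p : ℝ) ^ 2 + D * q ^ 2 ≤ N := by nlinarith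
  by_cases hp : p = 0
  · have hq2 : 4 ≤ q ^ 2 := by
      obtain ⟨c, rfl⟩ : ∃ c, q = 2 * c := ⟨q / 2, by omega⟩
      have : c ≠ 0 := by rintro rfl; simp at hq
      have := sq_pos_of_ne_zero this
      nlinarith
    have hq2' : (4 : ℝ) ≤ q ^ 2 := by exact_mod_cast hq2
    nlinarith [sq_nonneg (p : ℝ)]
  have hp1 : 1 ≤ p ^ 2 := by have := sq_pos_of_ne_zero hp; omega
  have hp1' : (1 : ℝ) ≤ p ^ 2 := by exact_mod_cast hp1
  have hpq : p * q ≤ -1 ∨ 1 ≤ p * q := by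
    have : p * q ≠ 0 := mul_ne_zero hp hq
    omega
  rcases hpq with hpq | hpq
  · have : (p : ℝ) * q ≤ -1 := by exact_mod_cast hpq
    nlinarith
  · have : 1 ≤ (p : ℝ) * q := by exact_mod_cast hpq
    nlinarith

lemma abs_bounds_of_mul {c c' n N : ℤ} (h : c * c' = n) (hn : 1 ≤ n) (hN : n ≤ N) :
    (-N ≤ c ∧ c ≤ N) ∧ -N ≤ c' ∧ c' ≤ N := by
  have h1 : |c| ≤ N := (Int.le_of_dvd (by omega) ((abs_dvd _ _).2 ⟨c', h.symm⟩)).trans hN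
  have h2 : |c'| ≤ N :=
    (Int.le_of_dvd (by omega) ((abs_dvd _ _).2 ⟨c, by rw [← h, mul_comm]⟩)).trans hN
  exact ⟨abs_le.1 h1, abs_le.1 h2⟩

lemma eq_three_of_gram {D m c c' n : ℤ} (hm : D % 4 = 1) (hmo : m % 2 = 1)
    (h1 : (m - 2) ^ 2 < D) (hm5 : 5 ≤ m) (hn : 1 ≤ n) (hn3 : n ≤ 3)
    (r1 : 2 * m * n = c ^ 2 + D * c' ^ 2) (r2 : c * c' = n) (hpar : c % 2 = c' % 2) :
    n = 3 ∧ (D = 21 ∨ D = 33) := by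
  obtain ⟨⟨l1, l2⟩, l3, l4⟩ := abs_bounds_of_mul r2 hn hn3
  have hD' : 3 * m - 6 < D := by nlinarith
  have key : m ≤ 8 ∨ 6 * m - 9 < D := by
    by_cases hm' : m ≤ 8
    · exact .inl hm'
    · right; nlinarith
  clear h1
  subst r2
  interval_cases c <;> interval_cases c' <;> omega

lemma false_of_gram_norm_one {D t t' p s : ℤ} (hD : D = 21 ∨ D = 33) (hp : p ^ 2 ≤ 6)
    (hs : s ^ 2 ≤ 6 - p ^ 2) (r1 : 12 * (6 - p ^ 2 - s ^ 2) = t ^ 2 + D * t' ^ 2)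
    (r2 : t * t' = 0) : False := by
  have hp' : p ^ 2 < 3 ^ 2 := by omega
  have hs' : s ^ 2 < 3 ^ 2 := by have := sq_nonneg p; omega
  have hD1 : 21 ≤ D := by omega
  have ht' : t' ^ 2 < 2 ^ 2 := by nlinarith [sq_nonneg p, sq_nonneg s, sq_nonneg t]
  have ht : t ^ 2 < 9 ^ 2 := by nlinarith [sq_nonneg p, sq_nonneg s, sq_nonneg t']
  have b1 := abs_lt_of_sq_lt_sq' hp' (by norm_num)
  have b2 := abs_lt_of_sq_lt_sq' hs' (by norm_num)
  have b3 := abs_lt_of_sq_lt_sq' ht (by norm_num)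
  have b4 := abs_lt_of_sq_lt_sq' ht' (by norm_num)
  have key : ∀ D ∈ ({21, 33} : Finset ℤ), ∀ p ∈ Finset.Ioo (-3 : ℤ) 3, ∀ s ∈ Finset.Ioo (-3 : ℤ) 3,
      ∀ t ∈ Finset.Ioo (-9 : ℤ) 9, ∀ t' ∈ Finset.Ioo (-2 : ℤ) 2, t * t' = 0 → s ^ 2 ≤ 6 - p ^ 2 →
      12 * (6 - p ^ 2 - s ^ 2) ≠ t ^ 2 + D * t' ^ 2 := by
    decide +kernel
  exact key D (by simpa using hD) p (by simpa using b1) s (by simpa using b2) t (by simpa using b3)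
    t' (by simpa using b4) r2 hs r1

namespace ComplementData

variable {D : ℤ} (C : ComplementData D)

/-- A version of `exists_represents_int` for integers too small to dominate the square of an
irrational element. -/
lemma exists_represents_sub_sq (hD : 13 ≤ D) (hm : D % 4 = 1) (n : ℤ) (hn : 0 < n)
    (hN : 4 * (n : ℝ) < D + 1 + 2 * √(D : ℝ)) :
    ∃ (p : ℤ) (y : C.M), p ^ 2 ≤ n ∧ (C.S y y).re = 2 * (n - p ^ 2) ∧ (C.S y y).im = 0 := by
  obtain ⟨p, q, y, a1, a2, a3, a4, a5, a6⟩ := C.exists_represents_int (by omega) n hn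
  obtain rfl := im_eq_zero_of_sq_le hD hm a1 a4 a5 hN
  have := parity_of_four_dvd hm a1
  obtain ⟨p, rfl⟩ : ∃ c, p = 2 * c := ⟨p / 2, by omega⟩
  exact ⟨p, y, by linarith, by linarith, by linarith⟩

lemma exists_inner_eq (hD : 13 ≤ D) (hm : D % 4 = 1) {a b : ℤ} {y z : C.M}
    (hy : (C.S y y).re = 2 * a) (hy1 : (C.S y y).im = 0) (hz : (C.S z z).re = 2 * b)
    (hz1 : (C.S z z).im = 0) (hN : 4 * (a * b : ℝ) < D + 1 + 2 * √(D : ℝ)) :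
    ∃ h : ℤ, (C.S y z).re = 2 * h ∧ (C.S y z).im = 0 ∧ h ^ 2 ≤ a * b := by
  have c1 := C.cauchy y z
  have c2 := C.cauchy_conj y z
  rw [hy, hy1, hz, hz1] at c1 c2
  push_cast at c1 c2
  have h0 := im_eq_zero_of_sq_le hD hm (C.integral y z) (N := 4 * (a * b : ℝ)) (by linarith)
    (by linarith) hN
  have := parity_of_four_dvd hm (C.integral y z)
  rw [h0] at this c1
  obtain ⟨p, hp⟩ : ∃ c, (C.S y z).re = 2 * c := ⟨(C.S y z).re / 2, by omega⟩
  refine ⟨p, hp, h0, ?_⟩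
  rw [hp] at c1
  push_cast at c1
  have : (p : ℝ) ^ 2 ≤ a * b := by linarith
  exact_mod_cast this

lemma half_false_of_norm_one (hD : 13 ≤ D) (hm : D % 4 = 1) {m : ℤ} (hmo : m % 2 = 1)
    (h1 : (m - 2) ^ 2 < D) (h2 : D < m ^ 2) (hm5 : 5 ≤ m) {f : C.M}
    (hf : (C.S f f).re = 2) (hf1 : (C.S f f).im = 0) : False := by
  have hD' : (13 : ℝ) ≤ D := by exact_mod_cast hD
  have hr3 : 3.5 < √(D : ℝ) := Real.lt_sqrt_of_sq_lt (by norm_num; linarith)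
  have hr : √(D : ℝ) ^ 2 = D := Real.sq_sqrt (by linarith)
  have hmr : m - √(D : ℝ) < 2 := by
    have h1' : ((m : ℝ) - 2) ^ 2 < D := by exact_mod_cast h1
    nlinarith
  obtain ⟨g, hg, hg1⟩ := C.exists_half_unit_multiple hD hm hmo h1 h2 hm5 1 (.inl rfl)
  obtain ⟨hfg1, a, hfg, ha⟩ := C.half_inner_bound (n := 1) hD hm hmo h1 h2 hm5 (.inl rfl)
    (.inl rfl) hf hf1 hg hg1
  obtain rfl : a = 0 := by
    push_cast at ha
    have : (a : ℝ) ^ 2 < 1 := by linarith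
    have : a ^ 2 < 1 := by exact_mod_cast this
    exact pow_eq_zero_iff (two_ne_zero) |>.1 (by have := sq_nonneg a; omega)
  obtain ⟨p, w, hp, hw, hw1⟩ := C.exists_represents_sub_sq hD hm 3 (by norm_num)
    (by push_cast; linarith)
  obtain ⟨h, hh, hh1, hle⟩ := C.exists_inner_eq hD hm (a := 1) hf hf1 hw hw1
    (by push_cast; nlinarith [sq_nonneg (p : ℝ)])
  have hpar := parity_of_four_dvd hm (C.integral g w)
  obtain ⟨r1, r2⟩ := C.gram_rel hf hf1 hfg hfg1 w
  rw [hg, hg1, hh, hh1, hw, hw1] at r1 r2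
  generalize (C.S g w).re = c at *
  generalize (C.S g w).im = c' at *
  have r1' : 2 * m * (3 - p ^ 2 - h ^ 2) = c ^ 2 + D * c' ^ 2 := by linarith
  have r2' : c * c' = 3 - p ^ 2 - h ^ 2 := by linarith
  have hp' := sq_nonneg p
  have hh' := sq_nonneg h
  have hn : 1 ≤ 3 - p ^ 2 - h ^ 2 := by
    have b1 := abs_lt_of_sq_lt_sq' (show p ^ 2 < 2 ^ 2 by omega) (by norm_num)
    have b2 := abs_lt_of_sq_lt_sq' (show h ^ 2 < 2 ^ 2 by omega) (by norm_num)
    obtain ⟨⟨b1, b2⟩, b3, b4⟩ := And.intro b1 b2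
    interval_cases p <;> interval_cases h <;> omega
  obtain ⟨h3, hDr⟩ := eq_three_of_gram hm hmo h1 hm5 hn (by omega) r1' r2' hpar
  obtain rfl : p = 0 := pow_eq_zero_iff (two_ne_zero) |>.1 (by omega)
  obtain rfl : h = 0 := pow_eq_zero_iff (two_ne_zero) |>.1 (by omega)
  have hD21 : (21 : ℝ) ≤ D := by rcases hDr with rfl | rfl <;> norm_num
  have hr4 : 4 < √(D : ℝ) := Real.lt_sqrt_of_sq_lt (by norm_num; linarith)
  obtain ⟨p, z, hp, hz, hz1⟩ := C.exists_represents_sub_sq hD hm 6 (by norm_num)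
    (by push_cast; linarith)
  obtain ⟨s, hs, hs1, hsle⟩ := C.exists_inner_eq hD hm (a := 1) hf hf1 hz hz1
    (by push_cast; nlinarith [sq_nonneg (p : ℝ)])
  obtain ⟨r1, r2⟩ := C.gram_rel hf hf1 (A := 0) (by simpa using hh) hh1 z
  rw [hs, hs1, hw, hw1, hz, hz1] at r1 r2
  generalize (C.S w z).re = t at *
  generalize (C.S w z).im = t' at *
  have r1' : 12 * (6 - p ^ 2 - s ^ 2) = t ^ 2 + D * t' ^ 2 := by linarith
  have r2' : t * t' = 0 := by linarith
  exact false_of_gram_norm_one hDr hp (by linarith) r1' r2'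

end ComplementData

lemma false_of_gram_thirteen {D a s u v : ℤ} (hD : D = 13 ∨ D = 17) (ha : a ^ 2 < 2 ^ 2)
    (hs : s ^ 2 < 2 ^ 2) (r1 : (5 - a ^ 2) * (5 - s ^ 2) - D = u ^ 2 + D * v ^ 2)
    (r2 : a ^ 2 - s ^ 2 = 2 * u * v) : False := by
  have hu : u ^ 2 < 4 ^ 2 := by
    rcases hD with rfl | rfl <;> nlinarith [sq_nonneg a, sq_nonneg s, sq_nonneg v]
  have hv : v ^ 2 < 1 ^ 2 := by
    rcases hD with rfl | rfl <;> nlinarith [sq_nonneg a, sq_nonneg s, sq_nonneg u]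
  have b1 := abs_lt_of_sq_lt_sq' ha (by norm_num)
  have b2 := abs_lt_of_sq_lt_sq' hs (by norm_num)
  have b3 := abs_lt_of_sq_lt_sq' hu (by norm_num)
  have b4 := abs_lt_of_sq_lt_sq' hv (by norm_num)
  have key : ∀ D ∈ ({13, 17} : Finset ℤ), ∀ a ∈ Finset.Ioo (-2 : ℤ) 2,
      ∀ s ∈ Finset.Ioo (-2 : ℤ) 2, ∀ u ∈ Finset.Ioo (-4 : ℤ) 4, ∀ v ∈ Finset.Ioo (-1 : ℤ) 1,
      a ^ 2 - s ^ 2 = 2 * u * v → (5 - a ^ 2) * (5 - s ^ 2) - D ≠ u ^ 2 + D * v ^ 2 := by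
    decide +kernel
  exact key D (by simpa using hD) a (by simpa using b1) s (by simpa using b2) u (by simpa using b3)
    v (by simpa using b4) r2 r1

lemma false_of_gram_twentyone {s₀ s₁ t₀ t₁ : ℤ} (hs : s₀ ^ 2 + 21 * s₁ ^ 2 ≤ 40)
    (r1 : 5 * (40 - s₀ ^ 2 - 21 * s₁ ^ 2) + 21 * (8 - 2 * s₀ * s₁) = 4 * (t₀ ^ 2 + 21 * t₁ ^ 2))
    (r2 : 5 * (8 - 2 * s₀ * s₁) + (40 - s₀ ^ 2 - 21 * s₁ ^ 2) = 8 * t₀ * t₁)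
    (h1 : s₀ % 2 = s₁ % 2) (h2 : t₀ % 2 = t₁ % 2) : False := by
  have b1 := abs_lt_of_sq_lt_sq' (show s₀ ^ 2 < 7 ^ 2 by nlinarith [sq_nonneg s₁]) (by norm_num)
  have b2 := abs_lt_of_sq_lt_sq' (show s₁ ^ 2 < 2 ^ 2 by nlinarith [sq_nonneg s₀]) (by norm_num)
  have b3 := abs_lt_of_sq_lt_sq' (show t₀ ^ 2 < 13 ^ 2 by
    nlinarith [sq_nonneg t₁, sq_nonneg s₀, sq_nonneg s₁, sq_nonneg (s₀ + 5 * s₁)]) (by norm_num)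
  have b4 := abs_lt_of_sq_lt_sq' (show t₁ ^ 2 < 3 ^ 2 by
    nlinarith [sq_nonneg t₀, sq_nonneg s₀, sq_nonneg s₁, sq_nonneg (s₀ + 5 * s₁)]) (by norm_num)
  have key : ∀ s₀ ∈ Finset.Ioo (-7 : ℤ) 7, ∀ s₁ ∈ Finset.Ioo (-2 : ℤ) 2,
      s₀ % 2 = s₁ % 2 → ∀ t₀ ∈ Finset.Ioo (-13 : ℤ) 13, ∀ t₁ ∈ Finset.Ioo (-3 : ℤ) 3,
      s₀ ^ 2 + 21 * s₁ ^ 2 ≤ 40 → t₀ % 2 = t₁ % 2 →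
      5 * (8 - 2 * s₀ * s₁) + (40 - s₀ ^ 2 - 21 * s₁ ^ 2) = 8 * t₀ * t₁ →
      5 * (40 - s₀ ^ 2 - 21 * s₁ ^ 2) + 21 * (8 - 2 * s₀ * s₁) ≠ 4 * (t₀ ^ 2 + 21 * t₁ ^ 2) := by
    decide +kernel
  exact key s₀ (by simpa using b1) s₁ (by simpa using b2) h1 t₀ (by simpa using b3)
    t₁ (by simpa using b4) hs h2 r2 r1

lemma false_of_gram_thirtythree {r s₀ s₁ A B : ℤ} (hr : r = 10 ∨ r = 9 ∨ r = 6)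
    (hs : s₀ ^ 2 + 33 * s₁ ^ 2 ≤ 8 * r)
    (r1 : 3 * (8 * r - s₀ ^ 2 - 33 * s₁ ^ 2) = 2 * (A ^ 2 + 33 * B ^ 2))
    (r2 : -3 * s₀ * s₁ = 2 * A * B)
    (h1 : s₀ % 2 = s₁ % 2) (h2 : A % 2 = B % 2) : False := by
  have hr' : r ≤ 10 := by omega
  have b1 := abs_lt_of_sq_lt_sq' (show s₀ ^ 2 < 9 ^ 2 by nlinarith [sq_nonneg s₁]) (by norm_num)
  have b2 := abs_lt_of_sq_lt_sq' (show s₁ ^ 2 < 2 ^ 2 by nlinarith [sq_nonneg s₀]) (by norm_num)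
  have b3 := abs_lt_of_sq_lt_sq' (show A ^ 2 < 11 ^ 2 by
    nlinarith [sq_nonneg B, sq_nonneg s₀, sq_nonneg s₁]) (by norm_num)
  have b4 := abs_lt_of_sq_lt_sq' (show B ^ 2 < 2 ^ 2 by
    nlinarith [sq_nonneg A, sq_nonneg s₀, sq_nonneg s₁]) (by norm_num)
  have key : ∀ r ∈ ({10, 9, 6} : Finset ℤ), ∀ s₀ ∈ Finset.Ioo (-9 : ℤ) 9,
      ∀ s₁ ∈ Finset.Ioo (-2 : ℤ) 2,
      s₀ % 2 = s₁ % 2 → ∀ A ∈ Finset.Ioo (-11 : ℤ) 11, ∀ B ∈ Finset.Ioo (-2 : ℤ) 2,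
      A % 2 = B % 2 → -3 * s₀ * s₁ = 2 * A * B →
      3 * (8 * r - s₀ ^ 2 - 33 * s₁ ^ 2) ≠ 2 * (A ^ 2 + 33 * B ^ 2) := by
    decide +kernel
  exact key r (by simpa using hr) s₀ (by simpa using b1) s₁ (by simpa using b2) h1
    A (by simpa using b3) B (by simpa using b4) h2 r2 r1

lemma false_of_gram_sixtyfive {D r s t t' : ℤ} (hD : D = 65 ∨ D = 85)
    (hr : r = 10 ∨ r = 9 ∨ r = 6) (hs : s ^ 2 ≤ 2 * r)
    (r1 : 10 * (2 * r - s ^ 2) = t ^ 2 + D * t' ^ 2) (r2 : t * t' = 0) (h : t % 2 = t' % 2) :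
    False := by
  have hr' : r ≤ 10 := by omega
  have hD' : 65 ≤ D := by omega
  have b1 := abs_lt_of_sq_lt_sq' (show s ^ 2 < 5 ^ 2 by omega) (by norm_num)
  have b2 := abs_lt_of_sq_lt_sq' (show t ^ 2 < 15 ^ 2 by nlinarith [sq_nonneg s, sq_nonneg t'])
    (by norm_num)
  have b3 := abs_lt_of_sq_lt_sq' (show t' ^ 2 < 2 ^ 2 by nlinarith [sq_nonneg s, sq_nonneg t])
    (by norm_num)
  have key : ∀ D ∈ ({65, 85} : Finset ℤ), ∀ r ∈ ({10, 9, 6} : Finset ℤ),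
      ∀ s ∈ Finset.Ioo (-5 : ℤ) 5, ∀ t ∈ Finset.Ioo (-15 : ℤ) 15, ∀ t' ∈ Finset.Ioo (-2 : ℤ) 2,
      s ^ 2 ≤ 2 * r → t % 2 = t' % 2 → t * t' = 0 →
      10 * (2 * r - s ^ 2) ≠ t ^ 2 + D * t' ^ 2 := by
    decide +kernel
  exact key D (by simpa using hD) r (by simpa using hr) s (by simpa using b1) t (by simpa using b2)
    t' (by simpa using b3) hs h r2 r1

lemma exceptional_of_gram {D m q h a u v : ℤ} (hm : D % 4 = 1) (hmo : m % 2 = 1)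
    (h1 : (m - 2) ^ 2 < D) (h2 : D < m ^ 2) (hD : 29 ≤ D) (hm5 : 5 ≤ m) (hq : q = 4 ∨ q = 5)
    (hh : h ^ 2 ≤ 2 * q) (ha : a ^ 2 < 2 ^ 2)
    (r1 : (m - a ^ 2) * (2 * q - h ^ 2) = u ^ 2 + D * v ^ 2) (r2 : 2 * q - h ^ 2 = 2 * u * v)
    (hpar : (u + a * h) % 2 = v % 2) :
    D = 45 ∨ (D = 33 ∧ a = 0 ∧ q = 5 ∧ (h = 2 ∨ h = -2)) ∨
      ((D = 65 ∨ D = 85) ∧ a = 0 ∧ q = 5 ∧ h = 0) := by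
  have key : m ≤ 8 ∨ 6 * m - 9 < D := by
    by_cases hm' : m ≤ 8
    · exact .inl hm'
    · right; nlinarith
  have key' : m ≤ 11 ∨ 10 * m - 25 < D := by
    by_cases hm' : m ≤ 11
    · exact .inl hm'
    · right; nlinarith
  have hm6 : 6 < m := by
    by_contra hc
    obtain rfl : m = 5 := by omega
    omega
  have hD2 : 2 * m < D := by nlinarith
  have h9 : m = 9 → 49 < D := by rintro rfl; omega
  have h11 : m = 11 → 81 < D := by rintro rfl; omega
  obtain ⟨b1, b2⟩ := abs_lt_of_sq_lt_sq' (show h ^ 2 < 4 ^ 2 by omega) (by norm_num)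
  obtain ⟨b3, b4⟩ := abs_lt_of_sq_lt_sq' ha (by norm_num)
  obtain ⟨h', rfl⟩ : ∃ h', h = 2 * h' := by
    refine ⟨h / 2, ?_⟩
    have : (h * h) % 2 = 0 := by
      have : h * h = 2 * (q - u * v) := by linarith
      omega
    rcases Int.emod_two_eq_zero_or_one h with h0 | h0
    · omega
    · rw [Int.mul_emod, h0] at this; norm_num at this
  clear h1 h2
  have huv : u * v = q - 2 * h' ^ 2 := by linarith
  have hp' : u % 2 = v % 2 := by
    have : u + a * (2 * h') = u + 2 * (a * h') := by ring
    omega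
  have hh' : -1 ≤ h' ∧ h' ≤ 1 := by omega
  obtain ⟨hh1, hh2⟩ := hh'
  have hq' : 1 ≤ q - 2 * h' ^ 2 ∧ q - 2 * h' ^ 2 ≤ 5 := by
    interval_cases h' <;> omega
  obtain ⟨⟨c1, c2⟩, c3, c4⟩ := abs_bounds_of_mul huv hq'.1 hq'.2
  clear ha hq' r2 hpar
  rcases hq with rfl | rfl <;> interval_cases h' <;> interval_cases u <;>
    first
    | omega
    | (interval_cases v <;> first | omega | (interval_cases a <;> omega))

namespace ComplementData

variable {D : ℤ} (C : ComplementData D)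

lemma false_of_norm_two_small (hD : D = 13 ∨ D = 17 ∨ D = 21) {f : C.M}
    (hf : (C.S f f).re = 4) (hf1 : (C.S f f).im = 0) : False := by
  have hD13 : 13 ≤ D := by omega
  have hm : D % 4 = 1 := by omega
  have h1 : (5 - 2) ^ 2 < D := by norm_num; omega
  have h2 : D < 5 ^ 2 := by norm_num; omega
  have hr0 : 0 ≤ √(D : ℝ) := Real.sqrt_nonneg _
  have hD' : (13 : ℝ) ≤ D := by exact_mod_cast hD13
  have hr3 : 3.5 < √(D : ℝ) := Real.lt_sqrt_of_sq_lt (by norm_num; linarith)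
  obtain ⟨g, hg, hg1⟩ := C.exists_half_unit_multiple hD13 hm (m := 5) (by norm_num) h1 h2
    (by norm_num) 1 (.inl rfl)
  obtain ⟨hfg1, a, hfg, ha⟩ := C.half_inner_bound (n := 2) hD13 hm (m := 5) (by norm_num) h1 h2
    (by norm_num) (.inl rfl) (.inr rfl) hf hf1 hg hg1
  push_cast at ha
  rw [← or_assoc] at hD
  rcases hD with hD | rfl
  · obtain ⟨y, hy, hy1⟩ := C.exists_half_unit_multiple hD13 hm (m := 5) (by norm_num) h1 h2
      (by norm_num) (-1) (.inr rfl)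
    obtain ⟨hfy1, s, hfy, hs⟩ := C.half_inner_bound (n := 2) hD13 hm (m := 5) (by norm_num) h1 h2
      (by norm_num) (.inr rfl) (.inr rfl) hf hf1 hy hy1
    push_cast at hs
    have ha' : (a : ℝ) ^ 2 < 2 ^ 2 := by linarith
    have hs' : (s : ℝ) ^ 2 < 2 ^ 2 := by linarith
    obtain ⟨r1, r2⟩ := C.gram_rel hf hf1 hfg hfg1 y
    rw [hg, hg1, hfy, hfy1, hy, hy1] at r1 r2
    exact false_of_gram_thirteen (a := a) (s := s) (u := (C.S g y).re - a * s)
      (v := (C.S g y).im) hD (by exact_mod_cast ha') (by exact_mod_cast hs')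
      (by linarith) (by linarith)
  · have hr4 : 4.5 < √((21 : ℤ) : ℝ) := Real.lt_sqrt_of_sq_lt (by norm_num)
    have hr5 : √((21 : ℤ) : ℝ) < 5 := (Real.sqrt_lt' (by norm_num)).2 (by norm_num)
    have ha' : (a : ℝ) ^ 2 < 1 := by push_cast at ha hr4; linarith
    have ha' : a ^ 2 < 1 := by exact_mod_cast ha'
    obtain rfl : a = 0 := pow_eq_zero_iff (two_ne_zero) |>.1 (by have := sq_nonneg a; omega)
    obtain ⟨p, q, y, a1, a2, a3, a4, a5, a6⟩ := C.exists_represents (by norm_num) 10 2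
      (by norm_num) (by push_cast at *; linarith) (by push_cast at *; linarith)
    obtain rfl : q = 0 := eq_zero_of_mul_sq_le (D := 21) (n := 20) (by omega) (by omega)
      (by nlinarith [sq_nonneg p])
    have hp : (p : ℝ) ^ 2 < 2 ^ 2 := by push_cast at *; nlinarith
    have hp : p ^ 2 < 2 ^ 2 := by exact_mod_cast hp
    obtain ⟨l1, l2⟩ := abs_lt_of_sq_lt_sq' hp (by norm_num)
    have := parity_of_four_dvd hm a1
    obtain rfl : p = 0 := by omega
    have hy : (C.S y y).re = 10 := by linarith
    have hy1 : (C.S y y).im = 2 := by linarith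
    have hb := C.sq_add_le (by norm_num) f y
    rw [hf, hf1, hy, hy1] at hb
    obtain ⟨r1, r2⟩ := C.gram_rel hf hf1 hfg hfg1 y
    rw [hg, hg1, hy, hy1] at r1 r2
    exact false_of_gram_twentyone hb (by linarith) (by linarith)
      (parity_of_four_dvd hm (C.integral f y)) (parity_of_four_dvd hm (C.integral g y))

lemma half_false_of_norm_two (hD : 29 ≤ D) (hD45 : D ≠ 45) (hm : D % 4 = 1) {m : ℤ}
    (hmo : m % 2 = 1) (h1 : (m - 2) ^ 2 < D) (h2 : D < m ^ 2) (hm5 : 5 ≤ m)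
    (hno : ∀ y : C.M, (C.S y y).im = 0 → (C.S y y).re ≠ 2) {f : C.M}
    (hf : (C.S f f).re = 4) (hf1 : (C.S f f).im = 0) : False := by
  have hD13 : 13 ≤ D := by omega
  have hD' : (29 : ℝ) ≤ D := by exact_mod_cast hD
  have hr5 : 5.35 < √(D : ℝ) := Real.lt_sqrt_of_sq_lt (by norm_num; linarith)
  have hr : √(D : ℝ) ^ 2 = D := Real.sq_sqrt (by linarith)
  have hmr : m - √(D : ℝ) < 2 := by
    have h1' : ((m : ℝ) - 2) ^ 2 < D := by exact_mod_cast h1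
    nlinarith
  obtain ⟨g, hg, hg1⟩ := C.exists_half_unit_multiple hD13 hm hmo h1 h2 hm5 1 (.inl rfl)
  obtain ⟨hfg1, a, hfg, ha⟩ := C.half_inner_bound (n := 2) hD13 hm hmo h1 h2 hm5 (.inl rfl)
    (.inr rfl) hf hf1 hg hg1
  push_cast at ha
  have ha' : (a : ℝ) ^ 2 < 2 ^ 2 := by linarith
  have ha' : a ^ 2 < 2 ^ 2 := by exact_mod_cast ha'
  obtain ⟨v, hv, hv1⟩ := C.exists_norm_four_or_five (by omega) hno (fun p q b1 b2 b3 =>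
    im_eq_zero_of_sq_le hD13 hm b1 b2 b3 (by linarith))
  obtain ⟨q, hq, hvq⟩ : ∃ q : ℤ, (q = 4 ∨ q = 5) ∧ (C.S v v).re = 2 * q := by
    rcases hv with hv | hv
    · exact ⟨4, .inl rfl, hv⟩
    · exact ⟨5, .inr rfl, hv⟩
  have hq5 : (q : ℝ) ≤ 5 := by rcases hq with rfl | rfl <;> norm_num
  obtain ⟨h, hh, hh1, hle⟩ := C.exists_inner_eq hD13 hm (a := 2) hf hf1 hvq hv1
    (by push_cast; linarith)
  have hpar := parity_of_four_dvd hm (C.integral g v)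
  obtain ⟨r1, r2⟩ := C.gram_rel hf hf1 hfg hfg1 v
  rw [hg, hg1, hh, hh1, hvq, hv1] at r1 r2
  obtain ⟨p, y, hp, hy, hy1⟩ := C.exists_represents_sub_sq hD13 hm 10 (by norm_num)
    (by push_cast; linarith)
  have hr10 : 10 - p ^ 2 = 10 ∨ 10 - p ^ 2 = 9 ∨ 10 - p ^ 2 = 6 := by
    have := hno y hy1
    obtain ⟨l1, l2⟩ := abs_lt_of_sq_lt_sq' (show p ^ 2 < 4 ^ 2 by omega) (by norm_num)
    interval_cases p <;> omega
  have hp10 := sq_nonneg (p : ℝ)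
  have hpy := parity_of_four_dvd hm (C.integral v y)
  have hpf := parity_of_four_dvd hm (C.integral f y)
  obtain ⟨y1, y2⟩ := C.gram_rel hf hf1 hh hh1 y
  rw [hvq, hv1, hy, hy1] at y1 y2
  rcases exceptional_of_gram (h := h) (u := (C.S g v).re - a * h) (v := (C.S g v).im)
      hm hmo h1 h2 hD hm5
    hq (by linarith) ha' (by linarith) (by linarith) (by rw [sub_add_cancel]; exact hpar) with
    hD | ⟨rfl, -, rfl, hh⟩ | ⟨hD, -, rfl, rfl⟩
  · exact hD45 hD
  · have hb := C.sq_add_le (by norm_num) f y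
    rw [hf, hf1, hy, hy1] at hb
    rcases hh with rfl | rfl
    · exact false_of_gram_thirtythree (A := (C.S v y).re - (C.S f y).re)
        (B := (C.S v y).im - (C.S f y).im) hr10 (by linarith) (by linarith) (by linarith) hpf
        (by omega)
    · exact false_of_gram_thirtythree (A := (C.S v y).re + (C.S f y).re)
        (B := (C.S v y).im + (C.S f y).im) hr10 (by linarith) (by linarith) (by linarith) hpf
        (by omega)
  · have hD65 : (65 : ℝ) ≤ D := by rcases hD with rfl | rfl <;> norm_num
    have hr8 : 8 < √(D : ℝ) := Real.lt_sqrt_of_sq_lt (by norm_num; linarith)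
    obtain ⟨s, hs, hs1, hsle⟩ := C.exists_inner_eq hD13 hm (a := 2) hf hf1 hy hy1
      (by push_cast; linarith)
    rw [hs, hs1] at y1 y2
    exact false_of_gram_sixtyfive hD hr10 hsle (by linarith) (by linarith) hpy

lemma false_of_mod_four_eq_one {D : ℤ} (C : ComplementData D) (hD : 13 ≤ D)
    (hD45 : D ≠ 45) (hm : D % 4 = 1) {m : ℤ}
    (hmo : m % 2 = 1) (h1 : (m - 2) ^ 2 < D) (h2 : D < m ^ 2) (hm5 : 5 ≤ m) : False := by
  have hno : ∀ y : C.M, (C.S y y).im = 0 → (C.S y y).re ≠ 2 :=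
    fun y hy1 hy => C.half_false_of_norm_one hD hm hmo h1 h2 hm5 hy hy1
  obtain ⟨f, hf | hf, hf1⟩ := C.exists_norm_one_or_two (by omega) (fun p q a1 a2 =>
    eq_zero_of_mul_sq_le (D := D) (n := 8) (by omega) (by omega) (by nlinarith [sq_nonneg p]))
  · exact hno f hf1 hf
  · by_cases hD29 : 29 ≤ D
    · exact C.half_false_of_norm_two hD29 hD45 hm hmo h1 h2 hm5 hno hf hf1
    · have h25 : D ≠ 25 := by
        rintro rfl
        have : m < 7 := by nlinarith
        obtain rfl : m = 5 := by omega
        omega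
      exact C.false_of_norm_two_small (by omega) hf hf1

end ComplementData

section QuadraticField

variable {D : ℤ} {K : Type} [Field K] {sd : K}

lemma not_isSquare_of_squarefree (hD : 1 < D) (hsf : Squarefree D) : ¬ IsSquare D := by
  rintro ⟨c, rfl⟩
  have := (Int.isUnit_iff.1 (hsf c dvd_rfl))
  rcases this with rfl | rfl <;> simp at hD

lemma exists_ratCast_algEquiv [CharZero K] (hD : 1 < D) (hsf : Squarefree D)
    (hsd : sd ^ 2 = (D : K)) (hdeg : Module.finrank ℚ K = 2) :
    ∃ φ : QuadraticAlgebra ℚ (D : ℚ) 0 ≃ₐ[ℚ] K, φ QuadraticAlgebra.omega = sd := by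
  have : Fact (∀ r : ℚ, r ^ 2 ≠ (D : ℚ) + 0 * r) := ⟨fun r hr =>
    not_isSquare_of_squarefree hD hsf (Rat.isSquare_intCast_iff.1 ⟨r, by linarith⟩)⟩
  let φ : QuadraticAlgebra ℚ (D : ℚ) 0 →ₐ[ℚ] K :=
    QuadraticAlgebra.lift ⟨sd, by simp [Algebra.smul_def, ← hsd, pow_two]⟩
  have hinj : Function.Injective φ.toLinearMap := φ.toRingHom.injective
  have hfin : FiniteDimensional ℚ K := Module.finite_of_finrank_eq_succ hdeg
  have hbij : Function.Bijective φ := ⟨hinj,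
    (LinearMap.injective_iff_surjective_of_finrank_eq_finrank
    (by rw [hdeg, QuadraticAlgebra.finrank_eq_two])).1 hinj⟩
  exact ⟨AlgEquiv.ofBijective φ hbij, by simp [φ]⟩

lemma exists_ringHom_map_eq [CharZero K] (hD : 1 < D) (hsf : Squarefree D)
    (hsd : sd ^ 2 = (D : K)) (hdeg : Module.finrank ℚ K = 2) {R : Type} [Field R] [CharZero R]
    {u : R} (hu : u ^ 2 = (D : R)) : ∃ φ : K →+* R, φ sd = u := by
  obtain ⟨φ, hφ⟩ := exists_ratCast_algEquiv hD hsf hsd hdeg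
  let ψ : QuadraticAlgebra ℚ (D : ℚ) 0 →ₐ[ℚ] R :=
    QuadraticAlgebra.lift ⟨u, by simp [Algebra.smul_def, ← hu, pow_two]⟩
  refine ⟨ψ.toRingHom.comp φ.symm.toRingEquiv.toRingHom, ?_⟩
  have : φ.symm sd = QuadraticAlgebra.omega := by rw [← hφ, AlgEquiv.symm_apply_apply]
  simp [this, ψ]

lemma exists_eq_add_mul [CharZero K] (hD : 1 < D) (hsf : Squarefree D)
    (hsd : sd ^ 2 = (D : K)) (hdeg : Module.finrank ℚ K = 2) (x : K) :
    ∃ p q : ℚ, x = p + q * sd := by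
  obtain ⟨φ, hφ⟩ := exists_ratCast_algEquiv hD hsf hsd hdeg
  obtain ⟨⟨p, q⟩, rfl⟩ := φ.surjective x
  refine ⟨p, q, ?_⟩
  rw [QuadraticAlgebra.mk_eq_add_smul_omega, map_add, map_smul, hφ, AlgEquiv.commutes,
    Algebra.smul_def]
  simp

lemma exists_intCast_eq_of_squarefree_mul_sq (hsf : Squarefree D) {r : ℚ} {n : ℤ}
    (h : D * r ^ 2 = n) : ∃ b : ℤ, r = b := by
  have hd : (r.den : ℚ) ≠ 0 := by exact_mod_cast r.den_ne_zero
  have h1 : D * r.num ^ 2 = n * (r.den : ℤ) ^ 2 := by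
    have : (D : ℚ) * r.num ^ 2 = n * (r.den : ℚ) ^ 2 := by
      rw [← h]
      nth_rewrite 2 [← Rat.num_div_den r]
      field_simp
    exact_mod_cast this
  have hcop : IsCoprime ((r.den : ℤ) ^ 2) (r.num ^ 2) := by
    refine IsCoprime.pow ?_
    rw [Int.isCoprime_iff_gcd_eq_one, Int.gcd_comm]
    simpa [Int.gcd] using r.reduced
  have h2 : (r.den : ℤ) ^ 2 ∣ D := hcop.dvd_of_dvd_mul_right ⟨n, by rw [h1, mul_comm]⟩
  have h3 : IsUnit (r.den : ℤ) := hsf _ (by rwa [← pow_two])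
  have h4 : r.den = 1 := by simpa using Int.isUnit_iff_natAbs_eq.1 h3
  exact ⟨r.num, (Rat.den_eq_one_iff r).1 h4 |>.symm⟩

lemma exists_intCast_eq_of_isIntegral [CharZero K] {p : ℚ} (h : IsIntegral ℤ (p : K)) :
    ∃ a : ℤ, p = a := by
  have h' : IsIntegral ℤ p := by
    have := (isIntegral_algHom_iff (algebraMap ℚ K).toIntAlgHom
      (algebraMap ℚ K).injective (x := p)).1
    exact this (by simpa using h)
  obtain ⟨a, ha⟩ := IsIntegrallyClosed.isIntegral_iff.1 h'
  exact ⟨a, by simpa using ha.symm⟩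

lemma exists_two_mul_eq_of_isIntegral [CharZero K] (hD : 1 < D) (hsf : Squarefree D)
    (hsd : sd ^ 2 = (D : K)) (hdeg : Module.finrank ℚ K = 2) {x : K} (hx : IsIntegral ℤ x) :
    ∃ a b : ℤ, 2 * x = a + b * sd ∧ 4 ∣ a ^ 2 - D * b ^ 2 := by
  obtain ⟨p, q, rfl⟩ := exists_eq_add_mul hD hsf hsd hdeg x
  obtain ⟨c, hc⟩ := exists_ringHom_map_eq hD hsf hsd hdeg (u := -sd) (by rw [neg_sq, hsd])
  have hcx : IsIntegral ℤ ((p : K) - q * sd) := by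
    have := hx.map c.toIntAlgHom
    simpa [hc, sub_eq_add_neg] using this
  obtain ⟨a, ha⟩ := exists_intCast_eq_of_isIntegral (K := K) (p := 2 * p) (by
    have h : ((2 * p : ℚ) : K) = p + q * sd + (p - q * sd) := by push_cast; ring
    exact h ▸ hx.add hcx)
  obtain ⟨n, hn⟩ := exists_intCast_eq_of_isIntegral (K := K) (p := p ^ 2 - D * q ^ 2) (by
    have h : ((p ^ 2 - D * q ^ 2 : ℚ) : K) = (p + q * sd) * (p - q * sd) := by
      push_cast; linear_combination (q : K) ^ 2 * hsd
    exact h ▸ hx.mul hcx)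
  obtain ⟨b, hb⟩ := exists_intCast_eq_of_squarefree_mul_sq (r := 2 * q) (n := a ^ 2 - 4 * n) hsf
    (by push_cast; rw [← ha, ← hn]; ring)
  refine ⟨a, b, ?_, n, ?_⟩
  · have ha' : (2 * p : K) = a := by exact_mod_cast congrArg (Rat.cast (K := K)) ha
    have hb' : (2 * q : K) = b := by exact_mod_cast congrArg (Rat.cast (K := K)) hb
    rw [← ha', ← hb']; ring
  · have : (a : ℚ) ^ 2 - D * b ^ 2 = 4 * n := by rw [← ha, ← hb, ← hn]; ring
    exact_mod_cast this

lemma isIntegral_of_two_mul_eq [CharZero K] (hsd : sd ^ 2 = (D : K)) {x : K} {a b : ℤ}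
    (h : 2 * x = a + b * sd) (h4 : 4 ∣ a ^ 2 - D * b ^ 2) : IsIntegral ℤ x := by
  obtain ⟨n, hn⟩ := h4
  have hn' : (a : K) ^ 2 - D * b ^ 2 = 4 * n := by exact_mod_cast congrArg (Int.cast (R := K)) hn
  have h0 : x ^ 2 + (-a * x + n) = 0 := by
    have : (4 : K) ≠ 0 := by norm_num
    refine (mul_eq_zero.1 (?_ : 4 * (x ^ 2 + (-a * x + n)) = 0)).resolve_left this
    rw [← hsd] at hn'
    linear_combination (2 * x - a + b * sd) * h - hn'
  refine ⟨Polynomial.X ^ 2 + (Polynomial.C (-a) * Polynomial.X + Polynomial.C n), ?_, ?_⟩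
  · exact Polynomial.monic_X_pow_add (by
      refine (Polynomial.degree_linear_le).trans_lt ?_
      norm_num)
  · simpa only [Polynomial.eval₂_add, Polynomial.eval₂_mul, Polynomial.eval₂_X,
      Polynomial.eval₂_C, Polynomial.eval₂_X_pow, algebraMap_int_eq, Int.coe_castRingHom,
      Int.cast_neg] using h0

end QuadraticField

section QuadraticSpace

variable {K V : Type} [Field K] [AddCommGroup V] [Module K V] {L : Set V} {Q : QuadraticForm K V}

lemma map_smul_sub_smul (Q : QuadraticForm K V) (a b : K) (x y : V) :
    Q (a • x - b • y) = a ^ 2 * Q x + b ^ 2 * Q y - a * b * QuadraticMap.polar Q x y := by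
  rw [sub_eq_add_neg, ← neg_smul, QuadraticMap.map_add Q, QuadraticMap.map_smul,
    QuadraticMap.map_smul, QuadraticMap.polar_smul_left, QuadraticMap.polar_smul_right]
  simp only [smul_eq_mul]
  ring

lemma det_polar_eq_zero [CharZero K]
    (hrank : Module.finrank K (Submodule.span K L) = 3) {e : V} (he : e ∈ L)
    (hQe : Q e = 1) {y : Fin 3 → V} (hy : ∀ i, y i ∈ L)
    (hey : ∀ i, QuadraticMap.polar Q e (y i) = 0) :
    (Matrix.of fun i j => QuadraticMap.polar Q (y i) (y j)).det = 0 := by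
  have : Module.Finite K (Submodule.span K L) :=
    Module.finite_of_finrank_eq_succ hrank
  let v : Fin 4 → Submodule.span K L :=
    Fin.cons ⟨e, Submodule.subset_span he⟩ fun i => ⟨y i, Submodule.subset_span (hy i)⟩
  have hv : ¬ LinearIndependent K v := fun h => by
    have := h.fintype_card_le_finrank
    rw [hrank] at this
    simp at this
  obtain ⟨g, hg, i, hi⟩ := Fintype.not_linearIndependent_iff.1 hv
  have hg' : g 0 • e + ∑ i, g (Fin.succ i) • y i = 0 := by
    have := congrArg (Submodule.subtype _) hg
    rw [Fin.sum_univ_succ] at this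
    simpa [v] using this
  have hpair : ∀ z, g 0 * Q.polarBilin z e + ∑ i, g (Fin.succ i) * Q.polarBilin z (y i) = 0 := by
    intro z
    have := congrArg (Q.polarBilin z) hg'
    rw [map_add, map_sum, map_zero] at this
    simpa only [map_smul, smul_eq_mul] using this
  have hg0 : g 0 = 0 := by
    have := hpair e
    simpa [hey, QuadraticMap.polar_self, hQe] using this
  refine Matrix.exists_mulVec_eq_zero_iff.1 ⟨fun i => g (Fin.succ i), ?_, ?_⟩
  · intro h
    refine hi ?_
    refine Fin.cases hg0 (fun j => congrFun h j) i
  · ext i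
    have := hpair (y i)
    rw [hg0, zero_mul, zero_add] at this
    simpa [Matrix.mulVec, dotProduct, mul_comm] using this

lemma det_polar_three_eq_zero [CharZero K]
    (hrank : Module.finrank K (Submodule.span K L) = 3) {e x y z : V} (he : e ∈ L)
    (hQe : Q e = 1) (hx : x ∈ L) (hy : y ∈ L) (hz : z ∈ L) (hex : QuadraticMap.polar Q e x = 0)
    (hey : QuadraticMap.polar Q e y = 0) (hez : QuadraticMap.polar Q e z = 0) :
    let P := QuadraticMap.polar Q
    P x x * P y y * P z z + 2 * P x y * P x z * P y z - P x x * P y z ^ 2 - P y y * P x z ^ 2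
      - P z z * P x y ^ 2 = 0 := by
  intro P
  have h := det_polar_eq_zero (Q := Q) hrank he hQe (y := ![x, y, z])
    (by intro i; fin_cases i <;> simpa) (by intro i; fin_cases i <;> simpa)
  rw [Matrix.det_fin_three] at h
  simp only [Matrix.of_apply, Matrix.cons_val] at h
  rw [QuadraticMap.polar_comm Q y x, QuadraticMap.polar_comm Q z x,
    QuadraticMap.polar_comm Q z y] at h
  linear_combination h

end QuadraticSpace

section Lattice

variable {K V : Type} [Field K] [AddCommGroup V] [Module K V]
  [Module (𝓞 K) V] [IsScalarTower (𝓞 K) K V] {L : Submodule (𝓞 K) V} {Q : QuadraticForm K V}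

lemma smul_mem_of_isIntegral {a : K} (ha : IsIntegral ℤ a) {x : V} (hx : x ∈ L) : a • x ∈ L := by
  let α : 𝓞 K := ⟨a, ha⟩
  have h : a • x = α • x := algebraMap_smul K α x
  rw [h]
  exact L.smul_mem _ hx

lemma polar_sq_le (hclassical : ∀ x ∈ L, ∀ y ∈ L, IsIntegral ℤ (QuadraticMap.polar Q x y))
    (hposdef : ∀ x ∈ L, x ≠ 0 → ∀ σ : K →+* ℝ, 0 < σ (Q x)) {x y : V} (hx : x ∈ L) (hy : y ∈ L)
    (σ : K →+* ℝ) : σ (QuadraticMap.polar Q x y) ^ 2 ≤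
      σ (QuadraticMap.polar Q x x) * σ (QuadraticMap.polar Q y y) := by
  have hnonneg : ∀ z ∈ L, 0 ≤ σ (Q z) := fun z hz => by
    by_cases h : z = 0
    · simp [h]
    · exact (hposdef z hz h σ).le
  by_cases hy0 : y = 0
  · simp [hy0]
  have hpos := hposdef y hy hy0 σ
  have hz := hnonneg _ (L.sub_mem (smul_mem_of_isIntegral (hclassical y hy y hy) hx)
    (smul_mem_of_isIntegral (hclassical x hx y hy) hy))
  rw [map_smul_sub_smul] at hz
  rw [QuadraticMap.polar_self, QuadraticMap.polar_self] at *
  simp only [map_sub, map_add, map_mul, map_pow, nsmul_eq_mul, Nat.cast_ofNat, map_ofNat] at *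
  have h : 0 ≤ σ (Q y) * (4 * σ (Q x) * σ (Q y) - σ (QuadraticMap.polar Q x y) ^ 2) := by
    linarith
  linarith [nonneg_of_mul_nonneg_right h hpos]

end Lattice

lemma exists_complementData (D : ℤ) (hD : 1 < D) (hsf : Squarefree D)
    (K : Type) [Field K] [NumberField K]
    (sd : K) (hsd : sd ^ 2 = (D : K)) (hdeg : Module.finrank ℚ K = 2)
    (V : Type) [AddCommGroup V] [Module K V]
    [Module (𝓞 K) V] [IsScalarTower (𝓞 K) K V]
    (L : Submodule (𝓞 K) V) (Q : QuadraticForm K V)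
    (hrank : Module.finrank K (Submodule.span K (L : Set V)) = 3)
    (hclassical : ∀ x ∈ L, ∀ y ∈ L, IsIntegral ℤ ((Q (x + y) - Q x - Q y) / 2))
    (hposdef : ∀ x ∈ L, x ≠ 0 → ∀ σ : K →+* ℝ, 0 < σ (Q x))
    (huniversal : ∀ α : 𝓞 K, (∀ σ : K →+* ℝ, 0 < σ (α : K)) →
      ∃ x ∈ L, Q x = (α : K)) : Nonempty (ComplementData D) := by
  have hcl : ∀ x ∈ L, ∀ y ∈ L, IsIntegral ℤ (QuadraticMap.polar Q x y / 2) := hclassical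
  have hpol : ∀ x ∈ L, ∀ y ∈ L, IsIntegral ℤ (QuadraticMap.polar Q x y) := fun x hx y hy => by
    have := (hcl x hx y hy).add (hcl x hx y hy)
    rwa [add_halves] at this
  have hDR : √(D : ℝ) ^ 2 = D := Real.sq_sqrt (by exact_mod_cast (by omega : 0 ≤ D))
  obtain ⟨τ, hτ⟩ := exists_ringHom_map_eq hD hsf hsd hdeg hDR
  obtain ⟨τ', hτ'⟩ := exists_ringHom_map_eq hD hsf hsd hdeg (u := -√(D : ℝ)) (by rw [neg_sq, hDR])
  obtain ⟨e, he, hQe⟩ := huniversal 1 (by simp)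
  replace hQe : Q e = 1 := by simpa using hQe
  have hsd' : sd * sd = (D : K) := by rw [← hsd, pow_two]
  let ι : ℤ√D →+* K := Zsqrtd.lift ⟨sd, hsd'⟩
  have hι : ∀ z, ι z = z.re + z.im * sd := fun z => rfl
  have hιinj : Function.Injective ι := Zsqrtd.lift_injective _ fun n hn =>
    not_isSquare_of_squarefree hD hsf ⟨n, hn⟩
  let M : Type := {y : V // y ∈ L ∧ QuadraticMap.polar Q e y = 0}
  have hS : ∀ y z : M, ∃ s : ℤ√D,
      ι s = QuadraticMap.polar Q y.1 z.1 ∧ 4 ∣ s.re ^ 2 - D * s.im ^ 2 := fun y z => by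
    obtain ⟨a, b, h1, h2⟩ := exists_two_mul_eq_of_isIntegral hD hsf hsd hdeg
      (hcl y y.2.1 z z.2.1)
    refine ⟨⟨a, b⟩, ?_, h2⟩
    rw [hι, ← h1]
    field_simp
  choose S hS1 hS2 using hS
  have hSτ : ∀ y z : M, τ (QuadraticMap.polar Q y.1 z.1) = (S y z).re + (S y z).im * √(D : ℝ) :=
    fun y z => by rw [← hS1, hι]; simp [hτ]
  have hSτ' : ∀ y z : M, τ' (QuadraticMap.polar Q y.1 z.1) = (S y z).re - (S y z).im * √(D : ℝ) :=
    fun y z => by rw [← hS1, hι]; simp [hτ', sub_eq_add_neg]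
  have hnonneg : ∀ (σ : K →+* ℝ), ∀ y ∈ L, 0 ≤ σ (QuadraticMap.polar Q y y) := fun σ y hy => by
    by_cases h : y = 0
    · simp [h]
    · have := hposdef y hy h σ
      rw [QuadraticMap.polar_self, map_nsmul]
      exact nsmul_nonneg this.le 2
  refine ⟨⟨M, S, hS2, ?_, ?_, ?_, ?_, ?_, ?_⟩⟩
  · intro y z
    rw [← hSτ, ← hSτ, ← hSτ]
    exact polar_sq_le hpol hposdef y.2.1 z.2.1 τ
  · intro y z
    rw [← hSτ', ← hSτ', ← hSτ']
    exact polar_sq_le hpol hposdef y.2.1 z.2.1 τ'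
  · intro y
    rw [← hSτ]
    exact hnonneg τ y y.2.1
  · intro y
    rw [← hSτ']
    exact hnonneg τ' y y.2.1
  · intro x y z
    apply hιinj
    simp only [map_sub, map_add, map_mul, map_pow, map_ofNat, map_zero, hS1]
    exact det_polar_three_eq_zero hrank he hQe x.2.1 y.2.1 z.2.1 x.2.2 y.2.2 z.2.2
  · intro b h4 hb hb'
    have h2 : 2 * (ι b / 2) = b.re + b.im * sd := by rw [hι]; field_simp
    obtain ⟨x, hx, hQx⟩ := huniversal ⟨ι b / 2, isIntegral_of_two_mul_eq hsd h2 h4⟩ (by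
      intro σ
      have hσ : σ sd ^ 2 = √(D : ℝ) ^ 2 := by rw [← map_pow, hsd, hDR]; simp
      have : σ (ι b / 2) = (b.re + b.im * σ sd) / 2 := by rw [hι, map_div₀, map_ofNat]; simp
      change 0 < σ (ι b / 2)
      rw [this]
      rcases sq_eq_sq_iff_eq_or_eq_neg.1 hσ with h | h <;> rw [h] <;> linarith)
    replace hQx : Q x = ι b / 2 := hQx
    obtain ⟨p, q, hp, hpq⟩ := exists_two_mul_eq_of_isIntegral hD hsf hsd hdeg (hcl e he x hx)
    have hp' : QuadraticMap.polar Q e x = ι ⟨p, q⟩ := by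
      rw [hι, ← hp]; field_simp
    have hey : QuadraticMap.polar Q e (x - (QuadraticMap.polar Q e x / 2) • e) = 0 := by
      have : QuadraticMap.polar Q e e = 2 := by rw [QuadraticMap.polar_self, hQe]; simp
      rw [QuadraticMap.polar_sub_right, QuadraticMap.polar_smul_right, this]
      simp
    refine ⟨⟨p, q⟩, ⟨x - (QuadraticMap.polar Q e x / 2) • e,
      L.sub_mem hx (smul_mem_of_isIntegral (hcl e he x hx) he), hey⟩, hpq, ?_⟩
    apply hιinj
    simp only [map_sub, map_mul, map_pow, map_ofNat, hS1, ← hp']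
    have := map_smul_sub_smul Q 1 (QuadraticMap.polar Q e x / 2) x e
    rw [one_smul, hQe, hQx, QuadraticMap.polar_comm Q x e] at this
    rw [QuadraticMap.polar_self, this]
    simp only [nsmul_eq_mul, Nat.cast_ofNat]
    ring

/-- If `K = ℚ(√D)` (`D > 1` squarefree) admits a classical universal quadratic
`𝓞 K`-lattice `(L, Q)` of rank 3, then `D ∈ {2, 3, 5}`.  Here `(L, Q)` is a
finitely generated `𝓞 K`-submodule of a finite-dimensional `K`-vector space `V`
together with a quadratic form `Q : V → K`; it is integral (`Q` takes values in
`𝓞 K` on `L`), classical (the bilinear form `B x y = (Q(x+y) - Q x - Q y)/2`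
takes values in `𝓞 K` on `L`), totally positive definite, of rank
`dim_K (K·L) = 3`, and represents every totally positive element of `𝓞 K`. -/
theorem ternary_classical_universal_D_mem
    (D : ℤ) (hD : 1 < D) (hsf : Squarefree D)
    (K : Type) [Field K] [NumberField K]
    (sd : K) (hsd : sd ^ 2 = (D : K)) (hdeg : Module.finrank ℚ K = 2)
    (V : Type) [AddCommGroup V] [Module K V] [FiniteDimensional K V]
    [Module (𝓞 K) V] [IsScalarTower (𝓞 K) K V]
    (L : Submodule (𝓞 K) V) (hLfg : L.FG)
    (Q : QuadraticForm K V)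
    (hrank : Module.finrank K (Submodule.span K (L : Set V)) = 3)
    (hint : ∀ x ∈ L, IsIntegral ℤ (Q x))
    (hclassical : ∀ x ∈ L, ∀ y ∈ L, IsIntegral ℤ ((Q (x + y) - Q x - Q y) / 2))
    (hposdef : ∀ x ∈ L, x ≠ 0 → ∀ σ : K →+* ℝ, 0 < σ (Q x))
    (huniversal : ∀ α : 𝓞 K, (∀ σ : K →+* ℝ, 0 < σ (α : K)) →
      ∃ x ∈ L, Q x = (α : K)) :
    D = 2 ∨ D = 3 ∨ D = 5 := by
  obtain ⟨C⟩ := exists_complementData D hD hsf K sd hsd hdeg V L Q hrank hclassical hposdef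
    huniversal
  by_contra hcon
  have hnd : ∀ c : ℤ, c * c ∣ D → c = 1 ∨ c = -1 := fun c hc => Int.isUnit_iff.1 (hsf c hc)
  have h4 : D % 4 ≠ 0 := fun h => by have := hnd 2 (by omega); omega
  have h9 : D ≠ 9 := fun h => by have := hnd 3 (by omega); omega
  have h45 : D ≠ 45 := fun h => by have := hnd 3 (by omega); omega
  obtain ⟨k, hk0, hk1, hk2⟩ : ∃ k : ℤ, 0 ≤ k ∧ k ^ 2 < D ∧ D < (k + 1) ^ 2 := by
    lift D to ℕ using by omega
    refine ⟨D.sqrt, by positivity, ?_, ?_⟩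
    · refine lt_of_le_of_ne (by exact_mod_cast D.sqrt_le') fun h =>
        not_isSquare_of_squarefree hD hsf ⟨_, by rw [← pow_two, h]⟩
    · exact_mod_cast D.lt_succ_sqrt'
  by_cases hm : D % 4 = 1
  · have hD13 : 13 ≤ D := by omega
    have hk3 : 3 ≤ k := by nlinarith
    rcases Int.even_or_odd' k with ⟨j, hj | hj⟩
    · exact C.false_of_mod_four_eq_one hD13 h45 hm (m := k + 1) (by omega) (by nlinarith) hk2
        (by omega)
    · exact C.false_of_mod_four_eq_one hD13 h45 hm (m := k + 2) (by omega)
        (by simpa using hk1) (by nlinarith) (by omega)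
  · exact C.false_of_mod_four_ne_one (k := k + 1) (by omega) (by omega) (by simpa using hk1) hk2
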